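/- arXiv:1006.0311 — 3 statements merged into one kernel-verified Lean document; each statement's English description precedes it below -/
import Mathlib

section
/- (Generating tree for involutions avoiding (m+1)m⋯21.) Let ℓ ≥ 1, ε ∈ {0,1}, m = 2ℓ+ε, and let τ ∈ I_n^{(m)} with labels a_j = a_j(τ) for 1 ≤ j ≤ ℓ; set a_0 = 0. (i) The permutation σ of {1,…,n+1} with σ(n+1) = n+1 and σ(p) = τ(p) for p ≤ n lies in I_{n+1}^{(m)}, and its label is (a_1+1, a_2+1, …, a_ℓ+1) if ε = 1, and (1, a_2+1, …, a_ℓ+1) if ε = 0. (ii) For 1 ≤ i ≤ n+1, let π_i be the permutation of {1,…,n+2} defined by π_i(i) = n+2, π_i(n+2) = i, and π_i(φ(q)) = φ(τ(q)) for all q ∈ {1,…,n}, where φ(q) = q if q < i and φ(q) = q+1 if q ≥ i. Then π_i ∈ I_{n+2}^{(m)} if and only if i ≥ n+2−a_ℓ, and the multiset of labels { L(π_i) : n+2−a_ℓ ≤ i ≤ n+1 } equals the multiset { (a_1+1, …, a_{j−1}+1, α, a_{j+1}+2, …, a_ℓ+2) : 1 ≤ j ≤ ℓ, a_{j−1}+2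 ≤ α ≤ a_j+1 }. -/
open scoped Classical

noncomputable section

/-- `f` has a descending subsequence of length `k`. -/
def HasDescSeq {n : ℕ} (f : Fin n → Fin n) (k : ℕ) : Prop :=
  ∃ s : Fin k → Fin n, StrictMono s ∧ StrictAnti fun a => f (s a)

/-- The label statistic `a_j` for involutions avoiding `(m+1)m⋯21`, `m = 2ℓ+ε`:
`a_j = n+1 − max{ i_1 : ∃ i_1<⋯<i_j, f(i_1)>⋯>f(i_j) ≥ i_j+ε }` (positions and
values 1-based), and `a_j = n+1` when no such subsequence exists (then the
`sSup` below is `0`). -/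
def bStat {n : ℕ} (f : Fin n → Fin n) (ε j : ℕ) : ℕ :=
  n + 1 - sSup ({0} ∪ { v : ℕ | ∃ h : 0 < j, ∃ s : Fin j → Fin n,
    StrictMono s ∧ StrictAnti (fun a => f (s a)) ∧
    (s ⟨j - 1, Nat.sub_lt h Nat.one_pos⟩ : ℕ) + 1 + ε ≤
      (f (s ⟨j - 1, Nat.sub_lt h Nat.one_pos⟩) : ℕ) + 1 ∧
    v = (s ⟨0, h⟩ : ℕ) + 1 })

/-- Extension of `τ` to `{1,…,n+1}` fixing the new largest point `n+1`. -/
def extFun (n : ℕ) (τ : Equiv.Perm (Fin n)) : Fin (n + 1) → Fin (n + 1) :=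
  fun i => if h : (i : ℕ) < n then Fin.castSucc (τ ⟨(i : ℕ), h⟩) else Fin.last n

/-- The map `φ` (on 0-based values): `φ(q) = q` if `q+1 < i`, `φ(q) = q+1` otherwise. -/
def phiVal (n i : ℕ) (v : Fin n) : Fin (n + 2) :=
  if i ≤ (v : ℕ) + 1 then ⟨(v : ℕ) + 1, by have := v.isLt; omega⟩
  else ⟨(v : ℕ), by have := v.isLt; omega⟩

/-- Insertion of the 2-cycle `(i, n+2)` (1-based) in the involution `τ` of
`{1,…,n}`: the resulting map on `{1,…,n+2}` sends `i ↦ n+2`, `n+2 ↦ i` and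
`φ(q) ↦ φ(τ(q))` for the other points.  (For `1 ≤ i ≤ n+1` all the `dite`
side conditions hold.) -/
def insCycFun (n : ℕ) (τ : Equiv.Perm (Fin n)) (i : ℕ) : Fin (n + 2) → Fin (n + 2) :=
  fun p =>
    if (p : ℕ) + 1 = i then Fin.last (n + 1)
    else if (p : ℕ) = n + 1 then (if h : i - 1 < n + 2 then ⟨i - 1, h⟩ else p)
    else if (p : ℕ) + 1 < i then
      (if h : (p : ℕ) < n then phiVal n i (τ ⟨(p : ℕ), h⟩) else p)
    else
      (if h : (p : ℕ) - 1 < n then phiVal n i (τ ⟨(p : ℕ) - 1, h⟩) else p)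

/-- `p` starts a descending subsequence of `f` of length `k + 1` whose last point `q` satisfies
`q + ε ≤ f q`. -/
def StartsUpperChain {n : ℕ} (f : Fin n → Fin n) (ε k : ℕ) (p : Fin n) : Prop :=
  ∃ s : Fin (k + 1) → Fin n, StrictMono s ∧ StrictAnti (fun a => f (s a)) ∧
    (s (Fin.last k) : ℕ) + ε ≤ f (s (Fin.last k)) ∧ s 0 = p

theorem startsUpperChain_zero {n : ℕ} (f : Fin n → Fin n) (ε : ℕ) (p : Fin n) :
    StartsUpperChain f ε 0 p ↔ (p : ℕ) + ε ≤ f p := by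
  constructor
  · rintro ⟨s, -, -, h, rfl⟩
    exact h
  · intro h
    have : Subsingleton (Fin (0 + 1)) := inferInstanceAs (Subsingleton (Fin 1))
    exact ⟨fun _ => p, Subsingleton.strictMono _, Subsingleton.strictAnti _, h, rfl⟩

theorem startsUpperChain_succ {n : ℕ} (f : Fin n → Fin n) (ε k : ℕ) (p : Fin n) :
    StartsUpperChain f ε (k + 1) p ↔ ∃ q, p < q ∧ f q < f p ∧ StartsUpperChain f ε k q := by
  constructor
  · rintro ⟨s, hm, ha, h, rfl⟩
    refine ⟨s 1, hm Fin.zero_lt_one, ha Fin.zero_lt_one, fun a => s a.succ,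
      fun a b hab => hm (Fin.succ_lt_succ_iff.2 hab), fun a b hab => ha (Fin.succ_lt_succ_iff.2 hab),
      ?_, rfl⟩
    simpa using h
  · rintro ⟨q, hpq, hf, s, hm, ha, h, rfl⟩
    refine ⟨Fin.cons p s, ?_, ?_, ?_, rfl⟩
    · rw [Fin.strictMono_iff_lt_succ]
      intro a
      induction a using Fin.cases with
      | zero => simpa using hpq
      | succ a => simpa [← Fin.succ_castSucc] using hm a.castSucc_lt_succ
    · rw [Fin.strictAnti_iff_succ_lt]
      intro a
      induction a using Fin.cases with
      | zero => simpa using hf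
      | succ a => simpa [← Fin.succ_castSucc] using ha a.castSucc_lt_succ
    · simpa [← Fin.succ_last] using h

/-- The largest (one-based) start of an upper chain of length `k + 1`, or `0` if there is none. -/
def topStart {n : ℕ} (f : Fin n → Fin n) (ε k : ℕ) : ℕ :=
  sSup ({0} ∪ {v : ℕ | ∃ p, StartsUpperChain f ε k p ∧ v = (p : ℕ) + 1})

theorem bStat_succ {n : ℕ} (f : Fin n → Fin n) (ε k : ℕ) :
    bStat f ε (k + 1) = n + 1 - topStart f ε k := by
  unfold bStat topStart
  congr 3
  ext v
  constructor
  · rintro ⟨_, s, hm, ha, h, rfl⟩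
    exact ⟨s 0, ⟨s, hm, ha, by simp only [Fin.last]; simp at h; omega, rfl⟩, rfl⟩
  · rintro ⟨_, ⟨s, hm, ha, h, rfl⟩, rfl⟩
    exact ⟨k.succ_pos, s, hm, ha, by simp only [Fin.last] at h; simp; omega, rfl⟩

theorem le_topStart_iff {n : ℕ} (f : Fin n → Fin n) (ε k m : ℕ) :
    m ≤ topStart f ε k ↔ m = 0 ∨ ∃ p, StartsUpperChain f ε k p ∧ m ≤ (p : ℕ) + 1 := by
  have hb : BddAbove ({0} ∪ {v : ℕ | ∃ p, StartsUpperChain f ε k p ∧ v = (p : ℕ) + 1}) := by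
    refine ⟨n, ?_⟩
    rintro v (rfl | ⟨p, -, rfl⟩)
    · exact Nat.zero_le _
    · exact p.isLt
  constructor
  · intro h
    rcases Nat.sSup_mem ⟨0, Or.inl rfl⟩ hb with h0 | ⟨p, hp, h0⟩
    · exact Or.inl (Nat.le_zero.1 (h.trans_eq h0))
    · exact Or.inr ⟨p, hp, h.trans_eq h0⟩
  · rintro (rfl | ⟨p, hp, h⟩)
    · exact Nat.zero_le _
    · exact h.trans (le_csSup hb (Or.inr ⟨p, hp, rfl⟩))

theorem topStart_le {n : ℕ} (f : Fin n → Fin n) (ε k : ℕ) : topStart f ε k ≤ n := by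
  rcases (le_topStart_iff f ε k _).1 le_rfl with h | ⟨p, -, h⟩ <;> omega

theorem topStart_antitone {n : ℕ} (f : Fin n → Fin n) (ε : ℕ) : Antitone (topStart f ε) := by
  refine antitone_nat_of_succ_le fun k => (le_topStart_iff f ε k _).2 ?_
  rcases (le_topStart_iff f ε (k + 1) _).1 le_rfl with h | ⟨p, hp, h⟩
  · exact Or.inl h
  · obtain ⟨q, hpq, -, hq⟩ := (startsUpperChain_succ f ε k p).1 hp
    exact Or.inr ⟨q, hq, by have := Fin.lt_def.1 hpq; omega⟩

theorem topStart_eq_zero_iff {n : ℕ} (f : Fin n → Fin n) (ε k : ℕ) :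
    topStart f ε k = 0 ↔ ∀ p, ¬ StartsUpperChain f ε k p := by
  have := le_topStart_iff f ε k 1
  constructor
  · intro h p hp
    have := this.2 (Or.inr ⟨p, hp, by omega⟩)
    omega
  · intro h
    by_contra h0
    rcases this.1 (by omega) with h1 | ⟨p, hp, -⟩
    · omega
    · exact h p hp

/-- Upper chains of an involution can be reflected, so they detect long descending subsequences. -/
theorem hasDescSeq_iff {n : ℕ} {f : Fin n → Fin n} (hf : Function.Involutive f) {ε : ℕ}
    (hε : ε ≤ 1) (ℓ : ℕ) :
    HasDescSeq f (2 * ℓ + ε + 1) ↔ ∃ p, StartsUpperChain f ε ℓ p := by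
  constructor
  · rintro ⟨t, hm, ha⟩
    by_cases hc : (t ⟨ℓ, by omega⟩ : ℕ) + ε ≤ f (t ⟨ℓ, by omega⟩)
    · exact ⟨_, fun a => t ⟨a, by omega⟩, fun a b hab => hm hab, fun a b hab => ha hab, hc, rfl⟩
    · refine ⟨_, fun a => f (t ⟨2 * ℓ + ε - a, by omega⟩), fun a b hab => ha ?_,
        fun a b hab => ?_, ?_, rfl⟩
      · have := Fin.lt_def.1 hab
        rw [Fin.lt_def]
        dsimp only
        omega
      · simp only [hf _]
        refine hm ?_
        have := Fin.lt_def.1 hab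
        rw [Fin.lt_def]
        dsimp only
        omega
      · simp only [hf _, Fin.val_last]
        have e : 2 * ℓ + ε - ℓ = ℓ + ε := by omega
        simp only [e]
        interval_cases ε
        · simp only [Nat.add_zero] at hc ⊢
          omega
        · have hlt : (⟨ℓ, by omega⟩ : Fin (2 * ℓ + 1 + 1)) < ⟨ℓ + 1, by omega⟩ :=
            Fin.lt_def.2 (by simp)
          have h1 := Fin.lt_def.1 (hm hlt)
          have h2 := Fin.lt_def.1 (ha hlt)
          simp only at h1 h2
          omega
  · rintro ⟨p, s, hm, ha, h, rfl⟩
    have key : ∀ a : ℕ, ∀ ha : a < ℓ + 1, (s ⟨a, ha⟩ : ℕ) ≤ s (Fin.last ℓ) := fun a ha =>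
      Fin.le_def.1 (hm.monotone (Fin.le_last _))
    refine ⟨fun a => if h : (a : ℕ) < ℓ + 1 then s ⟨a, h⟩ else
      f (s ⟨2 * ℓ + ε - a, by omega⟩), fun a b hab => ?_, fun a b hab => ?_⟩
    · have hab' := Fin.lt_def.1 hab
      dsimp only
      split_ifs with h1 h2 h2
      · exact hm hab
      · rw [Fin.lt_def]
        have k1 := key a h1
        have k2 := Fin.le_def.1
          (ha.antitone (Fin.le_last (⟨2 * ℓ + ε - b, by omega⟩ : Fin (ℓ + 1))))
        rcases Nat.eq_zero_or_pos ε with h0 | h0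
        · have k3 := Fin.lt_def.1 (@ha ⟨2 * ℓ + ε - b, by omega⟩ (Fin.last ℓ)
            (Fin.lt_def.2 (by simp only [Fin.val_last]; omega)))
          simp only at k3
          omega
        · omega
      · omega
      · exact ha (Fin.lt_def.2 (by dsimp only; omega))
    · have hab' := Fin.lt_def.1 hab
      dsimp only
      split_ifs with h1 h2 h2
      · exact ha hab
      · omega
      · rw [hf, Fin.lt_def]
        have k1 := key (2 * ℓ + ε - b) (by omega)
        have k2 := Fin.le_def.1 (ha.antitone (Fin.le_last (⟨a, h2⟩ : Fin (ℓ + 1))))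
        rcases Nat.eq_zero_or_pos ε with h0 | h0
        · have k3 := Fin.lt_def.1 (@hm ⟨2 * ℓ + ε - b, by omega⟩ (Fin.last ℓ)
            (Fin.lt_def.2 (by simp only [Fin.val_last]; omega)))
          omega
        · omega
      · simp only [hf _]
        exact hm (Fin.lt_def.2 (by dsimp only; omega))

theorem not_hasDescSeq_iff {n : ℕ} {f : Fin n → Fin n} (hf : Function.Involutive f) {ε : ℕ}
    (hε : ε ≤ 1) (ℓ : ℕ) :
    ¬ HasDescSeq f (2 * ℓ + ε + 1) ↔ topStart f ε ℓ = 0 := by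
  rw [hasDescSeq_iff hf hε, topStart_eq_zero_iff, not_exists]

theorem extFun_castSucc {n : ℕ} (τ : Equiv.Perm (Fin n)) (q : Fin n) :
    extFun n τ q.castSucc = (τ q).castSucc := by
  simp [extFun]

theorem extFun_last {n : ℕ} (τ : Equiv.Perm (Fin n)) : extFun n τ (Fin.last n) = Fin.last n := by
  simp [extFun]

theorem extFun_involutive {n : ℕ} {τ : Equiv.Perm (Fin n)} (h : Function.Involutive τ) :
    Function.Involutive (extFun n τ) := by
  intro p
  induction p using Fin.lastCases with
  | last => rw [extFun_last, extFun_last]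
  | cast q => rw [extFun_castSucc, extFun_castSucc, h]

theorem startsUpperChain_extFun_castSucc {n : ℕ} (τ : Equiv.Perm (Fin n)) (ε k : ℕ) (q : Fin n) :
    StartsUpperChain (extFun n τ) ε k q.castSucc ↔ StartsUpperChain τ ε k q := by
  induction k generalizing q with
  | zero => simp [startsUpperChain_zero, extFun_castSucc]
  | succ k ih =>
    simp only [startsUpperChain_succ, Fin.exists_fin_succ', ih, extFun_castSucc, extFun_last,
      Fin.castSucc_lt_castSucc_iff]
    simp [Fin.not_lt.2 (Fin.le_last _)]

theorem startsUpperChain_extFun_last {n : ℕ} (τ : Equiv.Perm (Fin n)) (ε k : ℕ) :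
    StartsUpperChain (extFun n τ) ε k (Fin.last n) ↔ k = 0 ∧ ε = 0 := by
  cases k with
  | zero => simp [startsUpperChain_zero, extFun_last]
  | succ k => simp [startsUpperChain_succ, Fin.not_lt.2 (Fin.le_last _)]

theorem topStart_extFun {n : ℕ} (τ : Equiv.Perm (Fin n)) (ε k : ℕ) :
    topStart (extFun n τ) ε k = if ε = 0 ∧ k = 0 then n + 1 else topStart τ ε k := by
  refine eq_of_forall_le_iff fun m => ?_
  rw [le_topStart_iff, Fin.exists_fin_succ']
  simp only [startsUpperChain_extFun_castSucc, startsUpperChain_extFun_last]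
  split_ifs with h
  · constructor
    · rintro (h1 | ⟨q, -, h1⟩ | ⟨-, h1⟩)
      · omega
      · simp at h1
        omega
      · simpa using h1
    · intro h1
      exact Or.inr (Or.inr ⟨h.symm, h1⟩)
  · rw [and_comm] at h
    simp [h, le_topStart_iff]

section Insertion

variable {n i : ℕ}

theorem val_phiVal (q : Fin n) :
    (phiVal n i q : ℕ) = if i ≤ (q : ℕ) + 1 then (q : ℕ) + 1 else q := by
  unfold phiVal
  split_ifs <;> rfl

theorem phiVal_lt_phiVal {q r : Fin n} : phiVal n i q < phiVal n i r ↔ q < r := by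
  simp only [Fin.lt_def, val_phiVal]
  split_ifs <;> omega

theorem eq_phiVal_or (hi : 1 ≤ i) (hin : i ≤ n + 1) (p : Fin (n + 2)) :
    (∃ q, p = phiVal n i q) ∨ p = ⟨i - 1, by omega⟩ ∨ p = Fin.last (n + 1) := by
  simp only [Fin.ext_iff, val_phiVal, Fin.val_last]
  by_cases h1 : (p : ℕ) + 1 < i
  · refine Or.inl ⟨⟨p, by omega⟩, ?_⟩
    rw [if_neg (by simp; omega)]
  · by_cases h2 : (p : ℕ) = i - 1
    · exact Or.inr (Or.inl h2)
    · by_cases h3 : (p : ℕ) = n + 1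
      · exact Or.inr (Or.inr h3)
      · refine Or.inl ⟨⟨p - 1, by omega⟩, ?_⟩
        simp only
        rw [if_pos (by omega)]
        omega

theorem insCycFun_phiVal (τ : Equiv.Perm (Fin n)) (q : Fin n) :
    insCycFun n τ i (phiVal n i q) = phiVal n i (τ q) := by
  have hq := q.isLt
  unfold insCycFun
  simp only [val_phiVal]
  by_cases h : i ≤ (q : ℕ) + 1
  · simp only [if_pos h, Nat.add_sub_cancel]
    rw [if_neg (by omega), if_neg (by omega), if_neg (by omega), dif_pos hq]
  · simp only [if_neg h]
    rw [if_neg (by omega), if_neg (by omega), if_pos (by omega), dif_pos hq]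

theorem insCycFun_mk (hi : 1 ≤ i) (τ : Equiv.Perm (Fin n)) (h : i - 1 < n + 2) :
    insCycFun n τ i ⟨i - 1, h⟩ = Fin.last (n + 1) := by
  unfold insCycFun
  rw [if_pos]
  simp only
  omega

theorem insCycFun_last (hin : i ≤ n + 1) (τ : Equiv.Perm (Fin n)) :
    insCycFun n τ i (Fin.last (n + 1)) = ⟨i - 1, by omega⟩ := by
  unfold insCycFun
  rw [if_neg (by simp only [Fin.val_last]; omega), if_pos (by simp), dif_pos]

theorem insCycFun_involutive (hi : 1 ≤ i) (hin : i ≤ n + 1) {τ : Equiv.Perm (Fin n)}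
    (h : Function.Involutive τ) : Function.Involutive (insCycFun n τ i) := by
  intro p
  rcases eq_phiVal_or hi hin p with ⟨q, rfl⟩ | rfl | rfl
  · rw [insCycFun_phiVal, insCycFun_phiVal, h]
  · rw [insCycFun_mk hi, insCycFun_last hin]
  · rw [insCycFun_last hin, insCycFun_mk hi]

theorem not_startsUpperChain_insCycFun_last (hin : i ≤ n + 1) (τ : Equiv.Perm (Fin n))
    (ε k : ℕ) : ¬ StartsUpperChain (insCycFun n τ i) ε k (Fin.last (n + 1)) := by
  cases k with
  | zero =>
    rw [startsUpperChain_zero, insCycFun_last hin]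
    simp only [Fin.val_last]
    omega
  | succ k => simp [startsUpperChain_succ, Fin.not_lt.2 (Fin.le_last _)]

theorem startsUpperChain_insCycFun_phiVal (hi : 1 ≤ i) (hin : i ≤ n + 1)
    (τ : Equiv.Perm (Fin n)) {ε : ℕ} (hε : ε ≤ 1) (k : ℕ) (q : Fin n) :
    StartsUpperChain (insCycFun n τ i) ε k (phiVal n i q) ↔ StartsUpperChain τ ε k q := by
  induction k generalizing q with
  | zero =>
    rw [startsUpperChain_zero, startsUpperChain_zero, insCycFun_phiVal, val_phiVal, val_phiVal]
    split_ifs <;> omega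
  | succ k ih =>
    rw [startsUpperChain_succ, startsUpperChain_succ]
    constructor
    · rintro ⟨p, h1, h2, h3⟩
      rcases eq_phiVal_or hi hin p with ⟨r, rfl⟩ | rfl | rfl
      · rw [insCycFun_phiVal, insCycFun_phiVal, phiVal_lt_phiVal] at h2
        exact ⟨r, phiVal_lt_phiVal.1 h1, h2, (ih r).1 h3⟩
      · rw [insCycFun_mk hi] at h2
        exact absurd h2 (Fin.not_lt.2 (Fin.le_last _))
      · exact absurd h3 (not_startsUpperChain_insCycFun_last hin τ ε k)
    · rintro ⟨r, h1, h2, h3⟩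
      refine ⟨phiVal n i r, phiVal_lt_phiVal.2 h1, ?_, (ih r).2 h3⟩
      rwa [insCycFun_phiVal, insCycFun_phiVal, phiVal_lt_phiVal]

theorem startsUpperChain_insCycFun_mk_zero (hi : 1 ≤ i) (hin : i ≤ n + 1)
    (τ : Equiv.Perm (Fin n)) {ε : ℕ} (hε : ε ≤ 1) (h : i - 1 < n + 2) :
    StartsUpperChain (insCycFun n τ i) ε 0 ⟨i - 1, h⟩ := by
  rw [startsUpperChain_zero, insCycFun_mk hi]
  simp only [Fin.val_last]
  omega

theorem startsUpperChain_insCycFun_mk_succ (hi : 1 ≤ i) (hin : i ≤ n + 1)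
    (τ : Equiv.Perm (Fin n)) {ε : ℕ} (hε : ε ≤ 1) (k : ℕ) (h : i - 1 < n + 2) :
    StartsUpperChain (insCycFun n τ i) ε (k + 1) ⟨i - 1, h⟩ ↔ i ≤ topStart τ ε k := by
  rw [startsUpperChain_succ, le_topStart_iff]
  constructor
  · rintro ⟨p, h1, -, h3⟩
    rcases eq_phiVal_or hi hin p with ⟨r, rfl⟩ | rfl | rfl
    · refine Or.inr ⟨r, (startsUpperChain_insCycFun_phiVal hi hin τ hε k r).1 h3, ?_⟩
      rw [Fin.lt_def, val_phiVal] at h1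
      simp only at h1
      split_ifs at h1 <;> omega
    · exact absurd h1 (lt_irrefl _)
    · exact absurd h3 (not_startsUpperChain_insCycFun_last hin τ ε k)
  · rintro (h0 | ⟨r, h1, h2⟩)
    · omega
    · refine ⟨phiVal n i r, ?_, ?_, (startsUpperChain_insCycFun_phiVal hi hin τ hε k r).2 h1⟩
      · rw [Fin.lt_def, val_phiVal, if_pos h2]
        simp only
        omega
      · have := (τ r).isLt
        rw [insCycFun_mk hi, insCycFun_phiVal, Fin.lt_def, val_phiVal, Fin.val_last]
        split_ifs <;> omega

theorem le_topStart_insCycFun_iff (hi : 1 ≤ i) (hin : i ≤ n + 1) (τ : Equiv.Perm (Fin n))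
    {ε : ℕ} (hε : ε ≤ 1) (k m : ℕ) :
    m ≤ topStart (insCycFun n τ i) ε k ↔
      (m ≤ if i ≤ topStart τ ε k then topStart τ ε k + 1 else topStart τ ε k) ∨
        (StartsUpperChain (insCycFun n τ i) ε k ⟨i - 1, by omega⟩ ∧ m ≤ i) := by
  have hT := le_topStart_iff τ ε k
  rw [le_topStart_iff]
  constructor
  · rintro (rfl | ⟨p, h1, h2⟩)
    · exact Or.inl (Nat.zero_le _)
    · rcases eq_phiVal_or hi hin p with ⟨r, rfl⟩ | rfl | rfl
      · left
        rw [startsUpperChain_insCycFun_phiVal hi hin τ hε] at h1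
        have := (hT ((r : ℕ) + 1)).2 (Or.inr ⟨r, h1, le_rfl⟩)
        rw [val_phiVal] at h2
        split_ifs at h2 ⊢ <;> omega
      · exact Or.inr ⟨h1, by simp only at h2; omega⟩
      · exact absurd h1 (not_startsUpperChain_insCycFun_last hin τ ε k)
  · rintro (h | ⟨h1, h2⟩)
    · rcases (hT _).1 le_rfl with h0 | ⟨r, h1, h2⟩
      · left
        split_ifs at h <;> omega
      · refine Or.inr ⟨phiVal n i r, (startsUpperChain_insCycFun_phiVal hi hin τ hε k r).2 h1, ?_⟩
        have := (hT ((r : ℕ) + 1)).2 (Or.inr ⟨r, h1, le_rfl⟩)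
        rw [val_phiVal]
        split_ifs at h ⊢ <;> omega
    · exact Or.inr ⟨_, h1, by simp only; omega⟩

theorem topStart_insCycFun_zero (hi : 1 ≤ i) (hin : i ≤ n + 1) (τ : Equiv.Perm (Fin n))
    {ε : ℕ} (hε : ε ≤ 1) :
    topStart (insCycFun n τ i) ε 0 = if i ≤ topStart τ ε 0 then topStart τ ε 0 + 1 else i := by
  refine eq_of_forall_le_iff fun m => ?_
  rw [le_topStart_insCycFun_iff hi hin τ hε]
  simp only [startsUpperChain_insCycFun_mk_zero hi hin τ hε, true_and]
  split_ifs <;> omega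

theorem topStart_insCycFun_succ (hi : 1 ≤ i) (hin : i ≤ n + 1) (τ : Equiv.Perm (Fin n))
    {ε : ℕ} (hε : ε ≤ 1) (k : ℕ) :
    topStart (insCycFun n τ i) ε (k + 1) =
      if i ≤ topStart τ ε (k + 1) then topStart τ ε (k + 1) + 1
      else if i ≤ topStart τ ε k then i else topStart τ ε (k + 1) := by
  refine eq_of_forall_le_iff fun m => ?_
  rw [le_topStart_insCycFun_iff hi hin τ hε, startsUpperChain_insCycFun_mk_succ hi hin τ hε]
  split_ifs <;> omega

end Insertion

/-- An antitone sequence cuts an interval into consecutive blocks. -/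
theorem Ico_val_eq_bind {T : ℕ → ℕ} (hT : Antitone T) (ℓ : ℕ) :
    (Finset.Ico (T ℓ + 1) (T 0 + 1)).val =
      Multiset.bind (Finset.Icc 1 ℓ).val
        (fun j => (Finset.Ico (T j + 1) (T (j - 1) + 1)).val) := by
  induction ℓ with
  | zero => simp
  | succ ℓ ih =>
    have h1 : (Finset.Icc 1 (ℓ + 1)).val = (ℓ + 1) ::ₘ (Finset.Icc 1 ℓ).val := by
      rw [← Finset.insert_Icc_right_eq_Icc_add_one (by omega), Finset.insert_val_of_notMem (by simp)]
    have h2 := hT ℓ.le_succ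
    have h3 := hT ℓ.zero_le
    rw [h1, Multiset.cons_bind, ← ih, Nat.add_sub_cancel]
    exact (Multiset.Ico_add_Ico_eq_Ico (by simpa using h2) (by simpa using h3)).symm

theorem Icc_val_eq_map_Ico {n a b : ℕ} (hb : b ≤ n + 1) :
    (Finset.Icc (n + 1 - b + 2) (n + 1 - a + 1)).val =
      Multiset.map (fun i => n + 3 - i) (Finset.Ico (a + 1) (b + 1)).val := by
  rw [← Finset.image_val_of_injOn]
  · congr 1
    ext x
    simp only [Finset.mem_Icc, Finset.mem_image, Finset.mem_Ico]
    constructor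
    · intro h
      exact ⟨n + 3 - x, by omega, by omega⟩
    · rintro ⟨i, h, rfl⟩
      omega
  · intro x hx y hy hxy
    simp only [Finset.coe_Ico, Set.mem_Ico] at hx hy hxy
    omega

/-- The generating tree for involutions avoiding `(m+1)m⋯21`, `m = 2ℓ+ε`:
(i) appending a fixed point gives an involution of `I_{n+1}^{(m)}` with label
`(a_1+1,…,a_ℓ+1)` if `ε = 1` and `(1, a_2+1,…,a_ℓ+1)` if `ε = 0`;
(ii) inserting the 2-cycle `(i, n+2)` is admissible iff `i ≥ n+2−a_ℓ`, and the
multiset of labels of the admissible insertions is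
`{(a_1+1,…,a_{j−1}+1, α, a_{j+1}+2,…,a_ℓ+2) : 1 ≤ j ≤ ℓ, a_{j−1}+2 ≤ α ≤ a_j+1}`
(with `a_0 = 0`). -/
theorem generating_tree_inv (ℓ ε n : ℕ) (hl : 1 ≤ ℓ) (hε : ε ≤ 1)
    (τ : Equiv.Perm (Fin n)) (hinv : Function.Involutive ⇑τ)
    (hav : ¬ HasDescSeq (⇑τ) (2 * ℓ + ε + 1)) :
    (Function.Involutive (extFun n τ) ∧
      ¬ HasDescSeq (extFun n τ) (2 * ℓ + ε + 1)) ∧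
    (∀ j, 1 ≤ j → j ≤ ℓ →
      bStat (extFun n τ) ε j =
        if ε = 0 ∧ j = 1 then 1 else bStat (⇑τ) ε j + 1) ∧
    (∀ i, 1 ≤ i → i ≤ n + 1 →
      ((Function.Involutive (insCycFun n τ i) ∧
          ¬ HasDescSeq (insCycFun n τ i) (2 * ℓ + ε + 1))
        ↔ n + 2 - bStat (⇑τ) ε ℓ ≤ i)) ∧
    (Multiset.map
        (fun i => fun k : Fin ℓ => bStat (insCycFun n τ i) ε ((k : ℕ) + 1))
        (Finset.Ico (n + 2 - bStat (⇑τ) ε ℓ) (n + 2)).val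
      = Multiset.bind (Finset.Icc 1 ℓ).val (fun j =>
          Multiset.map
            (fun α => fun k : Fin ℓ =>
              if (k : ℕ) + 1 < j then bStat (⇑τ) ε ((k : ℕ) + 1) + 1
              else if (k : ℕ) + 1 = j then α
              else bStat (⇑τ) ε ((k : ℕ) + 1) + 2)
            (Finset.Icc ((if 2 ≤ j then bStat (⇑τ) ε (j - 1) else 0) + 2)
              (bStat (⇑τ) ε j + 1)).val)) := by
  have hT := topStart_antitone τ ε
  have hTn := topStart_le τ ε
  have h0 : topStart τ ε ℓ = 0 := (not_hasDescSeq_iff hinv hε ℓ).1 hav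
  obtain ⟨d, rfl⟩ : ∃ d, ℓ = d + 1 := ⟨ℓ - 1, by omega⟩
  have hlast : n + 2 - bStat τ ε (d + 1) = topStart τ ε d + 1 := by
    have := hTn d
    rw [bStat_succ]
    omega
  refine ⟨⟨extFun_involutive hinv, ?_⟩, ?_, ?_, ?_⟩
  · rw [not_hasDescSeq_iff (extFun_involutive hinv) hε, topStart_extFun, if_neg (by omega), h0]
  · intro j h1 _
    obtain ⟨k, rfl⟩ : ∃ k, j = k + 1 := ⟨j - 1, by omega⟩
    have := hTn k
    rw [bStat_succ, bStat_succ, topStart_extFun]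
    simp only [Nat.add_eq_right]
    split_ifs <;> omega
  · intro i hi hin
    have hI := insCycFun_involutive hi hin hinv
    rw [not_hasDescSeq_iff hI hε, topStart_insCycFun_succ hi hin τ hε, h0, hlast]
    simp only [hI, true_and]
    split_ifs <;> omega
  · let T : ℕ → ℕ := fun j => if j = 0 then n + 1 else topStart τ ε (j - 1)
    have hTa : Antitone T := by
      refine antitone_nat_of_succ_le fun k => ?_
      cases k with
      | zero => simpa [T] using (hTn 0).trans n.le_succ
      | succ k => simpa [T] using hT k.le_succ
    have hTle : ∀ j, T j ≤ n + 1 := fun j => hTa j.zero_le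
    have hb : ∀ j, bStat τ ε (j + 1) = n + 1 - T (j + 1) := fun j => bStat_succ _ _ _
    have e : Finset.Ico (n + 2 - bStat τ ε (d + 1)) (n + 2) =
        Finset.Ico (T (d + 1) + 1) (T 0 + 1) := by
      rw [hlast]
      simp [T]
    rw [e, Ico_val_eq_bind hTa, Multiset.map_bind]
    refine Multiset.bind_congr fun j hj => ?_
    rw [Finset.mem_val, Finset.mem_Icc] at hj
    obtain ⟨j, rfl⟩ : ∃ k, j = k + 1 := ⟨j - 1, by omega⟩
    have hprev : (if 2 ≤ j + 1 then bStat τ ε (j + 1 - 1) else 0) = n + 1 - T j := by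
      cases j with
      | zero => simp [T]
      | succ j => rw [if_pos (by omega), Nat.add_sub_cancel, hb]
    rw [hprev, hb, Icc_val_eq_map_Ico (hTle j), Multiset.map_map, Nat.add_sub_cancel]
    refine Multiset.map_congr rfl fun i hi => ?_
    rw [Finset.mem_val, Finset.mem_Ico] at hi
    funext ⟨k, hk⟩
    have hin : i ≤ n + 1 := by have := hTle j; omega
    have hstep : topStart (insCycFun n τ i) ε k =
        if i ≤ T (k + 1) then T (k + 1) + 1 else if i ≤ T k then i else T (k + 1) := by
      cases k with
      | zero =>
        rw [topStart_insCycFun_zero (by omega) hin τ hε]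
        simp [T, hin]
      | succ k => exact topStart_insCycFun_succ (by omega) hin τ hε k
    simp only [Function.comp_apply, hb, bStat_succ (insCycFun n τ i), hstep]
    have hk1 := hTle (k + 1)
    rcases lt_trichotomy k j with h | rfl | h
    · have := hTa (show k + 1 ≤ j from h)
      rw [if_pos (by omega), if_pos (by omega)]
      omega
    · rw [if_neg (by omega), if_pos (by omega), if_neg (by omega), if_pos rfl]
    · have h1 := hTa (show j + 1 ≤ k from h)
      have h2 := hTa k.le_succ
      simp only [Nat.succ_eq_add_one] at h2
      rw [if_neg (by omega), if_neg (by omega), if_neg (by omega), if_neg (by omega)]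
      omega
end
end

section
/- (Functional equation for involutions avoiding (m+1)m⋯21.) Let ℓ ≥ 1, ε ∈ {0,1}, m = 2ℓ+ε. For n ≥ 0, define the polynomial G_n(v_1,…,v_ℓ) = ∑_{τ ∈ I_n^{(m)}} v_1^{a_1(τ)} · ∏_{j=2}^{ℓ} v_j^{a_j(τ)−a_{j−1}(τ)} with integer coefficients, and set G_{−1} = 0; note G_0 = v_1. Then for every n ≥ 0 the following identity holds in the field ℚ(v_1,…,v_ℓ) of rational functions, with the convention v_{ℓ+1} = 1: G_{n+1} = ε·v_1·G_n + (1−ε)·v_1·G_n|_{v_1←v_2} + v_1 · ∑_{j=1}^{ℓ} v_j v_{j+1} · ( G_{n−1} − G_{n−1}|_{v_j←v_{j+1}} ) / ( v_j − v_{j+1} ), where G|_{v_j←v_{j+1}} denotes the polynomial obtained from G by substituting v_{j+1} for the variable v_j (and in particular G|_{v_ℓ←v_{ℓ+1}} means substituting 1 for v_ℓ). -/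
open scoped Classical

noncomputable section

/-- The polynomial `G_n(v_1,…,v_ℓ) = ∑_{τ∈I_n^{(m)}} v_1^{a_1} ∏_{j=2}^ℓ
v_j^{a_j−a_{j−1}}`, `m = 2ℓ+ε`.  With 0-based variable indices `j : Fin ℓ` the
exponent of `v_j` is `a_{j+1} − a_j` (with `a_0 = 0`). -/
def Gpoly (ℓ ε n : ℕ) : MvPolynomial (Fin ℓ) ℚ :=
  ∑ τ ∈ Finset.univ.filter (fun τ : Equiv.Perm (Fin n) =>
      Function.Involutive ⇑τ ∧ ¬ HasDescSeq (⇑τ) (2 * ℓ + ε + 1)),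
    ∏ j : Fin ℓ,
      MvPolynomial.X j ^
        (bStat (⇑τ) ε ((j : ℕ) + 1)
          - (if 1 ≤ (j : ℕ) then bStat (⇑τ) ε (j : ℕ) else 0))

/-- The field `ℚ(v_1,…,v_ℓ)` of rational functions. -/
abbrev RatFunField (ℓ : ℕ) : Type := FractionRing (MvPolynomial (Fin ℓ) ℚ)

/-- The canonical embedding `ℚ[v_1,…,v_ℓ] → ℚ(v_1,…,v_ℓ)`. -/
def toRF {ℓ : ℕ} : MvPolynomial (Fin ℓ) ℚ →+* RatFunField ℓ :=
  algebraMap (MvPolynomial (Fin ℓ) ℚ) (RatFunField ℓ)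

/-- There is a set of `j` nested arcs of `f` (points `p` with `p + ε ≤ f p`) whose left
endpoints are all at least `lo`. -/
def HasNest {n : ℕ} (f : Fin n → Fin n) (ε j lo : ℕ) : Prop :=
  ∃ C : Finset (Fin n), C.card = j ∧ (∀ p ∈ C, lo ≤ (p : ℕ) ∧ (p : ℕ) + ε ≤ (f p : ℕ)) ∧
    ∀ p ∈ C, ∀ q ∈ C, p < q → f q < f p

/-- The statistic `a_j`, with the convention `a_0 = 0`. -/
def label {n : ℕ} (f : Fin n → Fin n) (ε j : ℕ) : ℕ :=
  if 1 ≤ j then bStat f ε j else 0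

lemma HasNest.of_le {n : ℕ} {f : Fin n → Fin n} {ε j j' lo lo' : ℕ} (h : HasNest f ε j lo)
    (hj : j' ≤ j) (hlo : lo' ≤ lo) : HasNest f ε j' lo' := by
  obtain ⟨C, hC, h1, h2⟩ := h
  obtain ⟨D, hD, hDc⟩ := Finset.exists_subset_card_eq (hj.trans hC.ge)
  exact ⟨D, hDc, fun p hp => ⟨hlo.trans (h1 p (hD hp)).1, (h1 p (hD hp)).2⟩,
    fun p hp q hq => h2 p (hD hp) q (hD hq)⟩

lemma hasNest_zero {n : ℕ} (f : Fin n → Fin n) (ε lo : ℕ) : HasNest f ε 0 lo :=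
  ⟨∅, by simp⟩

lemma HasNest.lt {n : ℕ} {f : Fin n → Fin n} {ε j lo : ℕ} (h : HasNest f ε j lo)
    (hj : 1 ≤ j) : lo < n := by
  obtain ⟨C, hC, h1, -⟩ := h
  obtain ⟨p, hp⟩ := Finset.card_pos.mp (hj.trans hC.ge)
  exact (h1 p hp).1.trans_lt p.2

lemma hasDescSeq_iff_s13 {n : ℕ} (f : Fin n → Fin n) (k : ℕ) :
    HasDescSeq f k ↔
      ∃ C : Finset (Fin n), C.card = k ∧ ∀ p ∈ C, ∀ q ∈ C, p < q → f q < f p := by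
  constructor
  · rintro ⟨s, hs, ha⟩
    refine ⟨Finset.univ.image s, ?_, ?_⟩
    · rw [Finset.card_image_of_injective _ hs.injective, Finset.card_fin]
    · simp only [Finset.mem_image, Finset.mem_univ, true_and]
      rintro _ ⟨a, rfl⟩ _ ⟨b, rfl⟩ hab
      exact ha (hs.lt_iff_lt.mp hab)
  · rintro ⟨C, hC, h⟩
    refine ⟨C.orderEmbOfFin hC, (C.orderEmbOfFin hC).strictMono, fun a b hab => ?_⟩
    exact h _ (C.orderEmbOfFin_mem hC a) _ (C.orderEmbOfFin_mem hC b)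
      ((C.orderEmbOfFin hC).strictMono hab)

/-- An involution has a descending subsequence of length `2ℓ + ε + 1` exactly when it has
`ℓ + 1` nested arcs. -/
lemma hasDescSeq_iff_hasNest {n : ℕ} {f : Fin n → Fin n} (hf : Function.Involutive f)
    {ε : ℕ} (hε : ε ≤ 1) (ℓ : ℕ) :
    HasDescSeq f (2 * ℓ + ε + 1) ↔ HasNest f ε (ℓ + 1) 0 := by
  rw [hasDescSeq_iff_s13]
  constructor
  · rintro ⟨C, hC, h⟩
    set A := C.filter (fun p : Fin n => (p : ℕ) + ε ≤ f p) with hA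
    set B := C.filter (fun p : Fin n => (f p : ℕ) + ε ≤ p) with hB
    have hcard : 2 * ℓ + 1 ≤ A.card + B.card := by
      have hD : (C \ (A ∪ B)).card ≤ ε := by
        rcases Nat.le_one_iff_eq_zero_or_eq_one.mp hε with rfl | rfl
        · rw [Nat.le_zero, Finset.card_eq_zero, Finset.eq_empty_iff_forall_notMem]
          intro p hp
          simp only [hA, hB, Finset.mem_sdiff, Finset.mem_union, Finset.mem_filter] at hp
          obtain ⟨hpC, hp⟩ := hp
          simp only [hpC, true_and] at hp
          omega
        · rw [Finset.card_le_one]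
          have key : ∀ p ∈ C \ (A ∪ B), p ∈ C ∧ f p = p := by
            intro p hp
            simp only [hA, hB, Finset.mem_sdiff, Finset.mem_union, Finset.mem_filter] at hp
            obtain ⟨hpC, hp⟩ := hp
            simp only [hpC, true_and] at hp
            exact ⟨hpC, by ext; omega⟩
          intro p hp q hq
          have h1 := key p hp
          have h2 := key q hq
          have h3 := h p h1.1 q h2.1
          have h4 := h q h2.1 p h1.1
          rw [h1.2, h2.2] at h3 h4
          by_contra hne
          rcases lt_or_gt_of_ne hne with hlt | hlt
          · exact absurd (h3 hlt) (not_lt.mpr hlt.le)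
          · exact absurd (h4 hlt) (not_lt.mpr hlt.le)
      have h1 := Finset.card_union_le A B
      have h2 := Finset.le_card_sdiff (A ∪ B) C
      omega
    have hcase : ℓ + 1 ≤ A.card ∨ ℓ + 1 ≤ B.card := by omega
    rcases hcase with hc | hc
    · refine HasNest.of_le (j := A.card) ⟨A, rfl, fun p hp => ?_, fun p hp q hq => ?_⟩ hc le_rfl
      · exact ⟨Nat.zero_le _, (Finset.mem_filter.mp hp).2⟩
      · exact h p (Finset.mem_filter.mp hp).1 q (Finset.mem_filter.mp hq).1
    · refine HasNest.of_le (j := B.card)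
        ⟨B.image f, Finset.card_image_of_injective _ hf.injective, ?_, ?_⟩ hc le_rfl
      · simp only [Finset.mem_image, forall_exists_index, and_imp]
        rintro _ p hp rfl
        rw [hf p]
        exact ⟨Nat.zero_le _, (Finset.mem_filter.mp hp).2⟩
      · simp only [Finset.mem_image, forall_exists_index, and_imp]
        rintro _ p hp rfl _ q hq rfl hlt
        rw [hf p, hf q]
        by_contra hle
        rcases (not_lt.mp hle).lt_or_eq with h1 | h1
        · exact absurd (h p (Finset.mem_filter.mp hp).1 q (Finset.mem_filter.mp hq).1 h1)
            (not_lt.mpr hlt.le)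
        · rw [h1] at hlt
          exact lt_irrefl _ hlt
  · rintro ⟨C, hC, h1, h2⟩
    have hinter : (C ∩ C.image f).card ≤ 1 - ε := by
      have key : ∀ p ∈ C ∩ C.image f, p ∈ C ∧ f p = p ∧ ε = 0 := by
        intro p hp
        simp only [Finset.mem_inter, Finset.mem_image] at hp
        obtain ⟨hp, q, hq, hqp⟩ := hp
        have hfp : f p = q := by rw [← hqp, hf]
        have a1 := h1 p hp
        have a2 := h1 q hq
        rw [hqp] at a2
        rw [hfp] at a1
        have : p = q := by ext; omega
        exact ⟨hp, by rw [hfp, this], by omega⟩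
      rcases Nat.le_one_iff_eq_zero_or_eq_one.mp hε with rfl | rfl
      · rw [Finset.card_le_one]
        intro p hp q hq
        have k1 := key p hp
        have k2 := key q hq
        have h3 := h2 p k1.1 q k2.1
        have h4 := h2 q k2.1 p k1.1
        rw [k1.2.1, k2.2.1] at h3 h4
        by_contra hne
        rcases lt_or_gt_of_ne hne with hlt | hlt
        · exact absurd (h3 hlt) (not_lt.mpr hlt.le)
        · exact absurd (h4 hlt) (not_lt.mpr hlt.le)
      · rw [Nat.sub_self, Nat.le_zero, Finset.card_eq_zero, Finset.eq_empty_iff_forall_notMem]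
        intro p hp
        exact absurd (key p hp).2.2 one_ne_zero
    have hcard : 2 * ℓ + ε + 1 ≤ (C ∪ C.image f).card := by
      have h3 := Finset.card_union_add_card_inter C (C.image f)
      rw [Finset.card_image_of_injective _ hf.injective] at h3
      omega
    have anti : ∀ p ∈ C ∪ C.image f, ∀ q ∈ C ∪ C.image f, p < q → f q < f p := by
      have mixed : ∀ p ∈ C, ∀ r ∈ C, (p ≤ f r ∧ r ≤ f p) ∧ (p < f r → r < f p) := by
        intro p hp r hr
        have a1 := h1 p hp
        have a2 := h1 r hr
        have a3 := h2 p hp r hr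
        have a4 := h2 r hr p hp
        rcases lt_trichotomy p r with h | h | h
        · have := a3 h
          simp only [Fin.lt_def, Fin.le_def] at *
          omega
        · subst h
          simp only [Fin.lt_def, Fin.le_def] at *
          omega
        · have := a4 h
          simp only [Fin.lt_def, Fin.le_def] at *
          omega
      intro p hp q hq hpq
      rw [Finset.mem_union, Finset.mem_image] at hp hq
      rcases hp with hp | ⟨r, hr, rfl⟩ <;> rcases hq with hq | ⟨t, ht, rfl⟩
      · exact h2 p hp q hq hpq
      · rw [hf t]
        exact (mixed p hp t ht).2 hpq
      · exact absurd ((mixed q hq r hr).1.1) (not_le.mpr hpq)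
      · rw [hf r, hf t]
        by_contra hle
        rcases (not_lt.mp hle).lt_or_eq with h3 | h3
        · exact absurd (h2 r hr t ht h3) (not_lt.mpr hpq.le)
        · rw [h3] at hpq
          exact lt_irrefl _ hpq
    obtain ⟨D, hD, hDc⟩ := Finset.exists_subset_card_eq hcard
    exact ⟨D, hDc, fun p hp q hq => anti p (hD hp) q (hD hq)⟩

lemma exists_seq_iff_hasNest {n : ℕ} (f : Fin n → Fin n) (ε j i : ℕ) (hj : 1 ≤ j) :
    (∃ v ∈ { v : ℕ | ∃ h : 0 < j, ∃ s : Fin j → Fin n,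
      StrictMono s ∧ StrictAnti (fun a => f (s a)) ∧
      (s ⟨j - 1, Nat.sub_lt h Nat.one_pos⟩ : ℕ) + 1 + ε ≤
        (f (s ⟨j - 1, Nat.sub_lt h Nat.one_pos⟩) : ℕ) + 1 ∧
      v = (s ⟨0, h⟩ : ℕ) + 1 }, i < v) ↔ HasNest f ε j i := by
  constructor
  · rintro ⟨v, ⟨h, s, hs, ha, hl, rfl⟩, hi⟩
    refine ⟨Finset.univ.image s, ?_, ?_, ?_⟩
    · rw [Finset.card_image_of_injective _ hs.injective, Finset.card_fin]
    · simp only [Finset.mem_image, Finset.mem_univ, true_and]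
      rintro _ ⟨a, rfl⟩
      have h1 : s ⟨0, h⟩ ≤ s a := hs.monotone (Fin.mk_le_of_le_val (Nat.zero_le _))
      have hle : a ≤ ⟨j - 1, Nat.sub_lt h Nat.one_pos⟩ := by
        rw [Fin.le_def]; have := a.2; simp only; omega
      have h2 := hs.monotone hle
      have h3 := ha.antitone hle
      simp only [Fin.le_def] at h1 h2 h3
      omega
    · simp only [Finset.mem_image, Finset.mem_univ, true_and]
      rintro _ ⟨a, rfl⟩ _ ⟨b, rfl⟩ hab
      exact ha (hs.lt_iff_lt.mp hab)
  · rintro ⟨C, hC, h1, h2⟩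
    have hm := C.orderEmbOfFin_mem hC
    refine ⟨_, ⟨hj, C.orderEmbOfFin hC, (C.orderEmbOfFin hC).strictMono, fun a b hab => ?_, ?_,
      rfl⟩, ?_⟩
    · exact h2 _ (hm a) _ (hm b) ((C.orderEmbOfFin hC).strictMono hab)
    · have := (h1 _ (hm ⟨j - 1, Nat.sub_lt hj Nat.one_pos⟩)).2
      omega
    · have := (h1 _ (hm ⟨0, hj⟩)).1
      omega

lemma label_zero {n : ℕ} (f : Fin n → Fin n) (ε : ℕ) : label f ε 0 = 0 := rfl

lemma label_le {n : ℕ} (f : Fin n → Fin n) (ε j : ℕ) : label f ε j ≤ n + 1 := by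
  unfold label bStat
  split_ifs <;> omega

lemma add_label_lt_iff {n : ℕ} (f : Fin n → Fin n) (ε j : ℕ) {i : ℕ} (hi : i ≤ n) :
    i + label f ε j < n + 1 ↔ HasNest f ε j i := by
  rcases Nat.eq_zero_or_pos j with rfl | hj
  · simp only [label_zero, hasNest_zero, iff_true]
    omega
  · rw [← exists_seq_iff_hasNest f ε j i hj]
    unfold label bStat
    rw [if_pos (by omega)]
    set S := { v : ℕ | ∃ h : 0 < j, ∃ s : Fin j → Fin n,
      StrictMono s ∧ StrictAnti (fun a => f (s a)) ∧
      (s ⟨j - 1, Nat.sub_lt h Nat.one_pos⟩ : ℕ) + 1 + ε ≤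
        (f (s ⟨j - 1, Nat.sub_lt h Nat.one_pos⟩) : ℕ) + 1 ∧
      v = (s ⟨0, h⟩ : ℕ) + 1 } with hS
    have hb : ∀ v ∈ ({0} ∪ S : Set ℕ), v ≤ n := by
      rintro v (hv | ⟨h, s, -, -, -, rfl⟩)
      · rw [Set.mem_singleton_iff.mp hv]
        exact Nat.zero_le _
      · exact (s ⟨0, h⟩).2
    have hne : ({0} ∪ S : Set ℕ).Nonempty := ⟨0, Or.inl rfl⟩
    have hle : sSup ({0} ∪ S : Set ℕ) ≤ n := csSup_le hne hb
    have hlt := lt_csSup_iff (a := i) ⟨n, hb⟩ hne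
    have : i + (n + 1 - sSup ({0} ∪ S : Set ℕ)) < n + 1 ↔ i < sSup ({0} ∪ S : Set ℕ) := by
      omega
    rw [this, hlt]
    constructor
    · rintro ⟨v, hv | hv, hiv⟩
      · rw [Set.mem_singleton_iff.mp hv] at hiv
        omega
      · exact ⟨v, hv, hiv⟩
    · rintro ⟨v, hv, hiv⟩
      exact ⟨v, Or.inr hv, hiv⟩

lemma label_mono {n : ℕ} (f : Fin n → Fin n) (ε : ℕ) : Monotone (label f ε) := by
  refine monotone_nat_of_le_succ fun j => ?_
  by_contra hlt
  have h0 := label_le f ε j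
  have h1 := (add_label_lt_iff f ε (j + 1) (i := n - label f ε (j + 1)) (by omega)).mp (by omega)
  have h2 := (add_label_lt_iff f ε j (by omega)).mpr (h1.of_le (Nat.le_succ j) le_rfl)
  omega

lemma label_pos {n : ℕ} (f : Fin n → Fin n) (ε j : ℕ) : 1 ≤ label f ε (j + 1) := by
  by_contra h
  have := (add_label_lt_iff f ε (j + 1) le_rfl).mp (by omega)
  exact absurd (this.lt (by omega)) (lt_irrefl _)

lemma label_eq_of_forall {n : ℕ} (f : Fin n → Fin n) (ε j a : ℕ) (ha : a ≤ n + 1)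
    (h : ∀ i ≤ n, i + a < n + 1 ↔ HasNest f ε j i) : label f ε j = a := by
  have h0 := label_le f ε j
  rcases lt_trichotomy (label f ε j) a with hlt | he | hlt
  · have h1 := h (n - label f ε j) (by omega)
    rw [← add_label_lt_iff f ε j (by omega)] at h1
    omega
  · exact he
  · have h1 := h (n - a) (by omega)
    rw [← add_label_lt_iff f ε j (by omega)] at h1
    omega

/-- Extend `f` by a fixed point at the end. -/
def addFixed {n : ℕ} (f : Fin n → Fin n) : Fin (n + 1) → Fin (n + 1) :=
  Fin.lastCases (Fin.last n) (fun i => (f i).castSucc)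

lemma addFixed_last {n : ℕ} (f : Fin n → Fin n) : addFixed f (Fin.last n) = Fin.last n := by
  simp [addFixed]

lemma addFixed_castSucc {n : ℕ} (f : Fin n → Fin n) (i : Fin n) :
    addFixed f i.castSucc = (f i).castSucc := by
  simp [addFixed]

/-- The inclusion of the old points when the points `k` and `n + 1` are inserted. -/
def insEmb {n : ℕ} (k : Fin (n + 1)) : Fin n ↪o Fin (n + 2) :=
  (Fin.succAboveOrderEmb k).trans Fin.castSuccOrderEmb

/-- Extend `f` by the two-cycle exchanging `k` with a new last point. -/
def addArc {n : ℕ} (k : Fin (n + 1)) (f : Fin n → Fin n) : Fin (n + 2) → Fin (n + 2) :=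
  Fin.lastCases k.castSucc
    (Fin.succAboveCases k (Fin.last (n + 1)) (fun i => insEmb k (f i)))

lemma insEmb_apply {n : ℕ} (k : Fin (n + 1)) (i : Fin n) :
    insEmb k i = (k.succAbove i).castSucc := rfl

lemma addArc_last {n : ℕ} (k : Fin (n + 1)) (f : Fin n → Fin n) :
    addArc k f (Fin.last (n + 1)) = k.castSucc := by
  simp [addArc]

lemma addArc_castSucc {n : ℕ} (k : Fin (n + 1)) (f : Fin n → Fin n) :
    addArc k f k.castSucc = Fin.last (n + 1) := by
  simp [addArc]

lemma addArc_insEmb {n : ℕ} (k : Fin (n + 1)) (f : Fin n → Fin n) (i : Fin n) :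
    addArc k f (insEmb k i) = insEmb k (f i) := by
  simp [addArc, insEmb_apply]

lemma insEmb_cases {n : ℕ} (k : Fin (n + 1)) (p : Fin (n + 2)) :
    p = Fin.last (n + 1) ∨ p = k.castSucc ∨ ∃ i, p = insEmb k i := by
  induction p using Fin.lastCases with
  | last => exact Or.inl rfl
  | cast p =>
    right
    rcases Fin.eq_self_or_eq_succAbove k p with h | ⟨i, h⟩
    · exact Or.inl (by rw [h])
    · exact Or.inr ⟨i, by rw [h, insEmb_apply]⟩

lemma insEmb_val {n : ℕ} (k : Fin (n + 1)) (i : Fin n) :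
    (insEmb k i : ℕ) = if (i : ℕ) < k then (i : ℕ) else i + 1 := by
  rw [insEmb_apply, Fin.val_castSucc, Fin.succAbove]
  simp only [Fin.lt_def, Fin.val_castSucc]
  split_ifs <;> simp

lemma hasNest_addFixed_of_hasNest {n : ℕ} {f : Fin n → Fin n} {ε j lo : ℕ}
    (h : HasNest f ε j lo) : HasNest (addFixed f) ε j lo := by
  obtain ⟨C, hC, h1, h2⟩ := h
  refine ⟨C.map Fin.castSuccEmb, by rw [Finset.card_map, hC], ?_, ?_⟩
  · simp only [Finset.mem_map, Fin.castSuccEmb_apply, forall_exists_index, and_imp]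
    rintro _ p hp rfl
    simpa [addFixed_castSucc] using h1 p hp
  · simp only [Finset.mem_map, Fin.castSuccEmb_apply, forall_exists_index, and_imp]
    rintro _ p hp rfl _ q hq rfl hpq
    simpa [addFixed_castSucc] using h2 p hp q hq (by simpa using hpq)

lemma hasNest_of_addFixed {n : ℕ} {f : Fin n → Fin n} {ε j lo : ℕ} {C : Finset (Fin (n + 1))}
    (hC : C.card = j) (h1 : ∀ p ∈ C, lo ≤ (p : ℕ) ∧ (p : ℕ) + ε ≤ (addFixed f p : ℕ))
    (h2 : ∀ p ∈ C, ∀ q ∈ C, p < q → addFixed f q < addFixed f p) (h3 : Fin.last n ∉ C) :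
    HasNest f ε j lo := by
  refine ⟨Finset.univ.filter (fun i => i.castSucc ∈ C), ?_, ?_, ?_⟩
  · rw [← hC, ← Finset.card_map Fin.castSuccEmb]
    congr 1
    ext p
    simp only [Finset.mem_map, Finset.mem_filter, Finset.mem_univ, true_and,
      Fin.castSuccEmb_apply]
    constructor
    · rintro ⟨i, hi, rfl⟩
      exact hi
    · intro hp
      induction p using Fin.lastCases with
      | last => exact absurd hp h3
      | cast p => exact ⟨p, hp, rfl⟩
  · intro p hp
    simpa [addFixed_castSucc] using h1 p.castSucc (Finset.mem_filter.mp hp).2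
  · intro p hp q hq hpq
    simpa [addFixed_castSucc] using h2 p.castSucc (Finset.mem_filter.mp hp).2 q.castSucc
      (Finset.mem_filter.mp hq).2 (by simpa using hpq)

lemma hasNest_addFixed_one {n : ℕ} (f : Fin n → Fin n) (j lo : ℕ) :
    HasNest (addFixed f) 1 j lo ↔ HasNest f 1 j lo := by
  refine ⟨?_, hasNest_addFixed_of_hasNest⟩
  rintro ⟨C, hC, h1, h2⟩
  refine hasNest_of_addFixed hC h1 h2 fun hl => ?_
  have := (h1 _ hl).2
  rw [addFixed_last] at this
  omega

lemma hasNest_addFixed_zero {n : ℕ} (f : Fin n → Fin n) (j lo : ℕ) (hj : j ≠ 1) :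
    HasNest (addFixed f) 0 j lo ↔ HasNest f 0 j lo := by
  refine ⟨?_, hasNest_addFixed_of_hasNest⟩
  rintro ⟨C, hC, h1, h2⟩
  refine hasNest_of_addFixed hC h1 h2 fun hl => hj ?_
  rw [← hC, Finset.card_eq_one]
  refine ⟨_, Finset.eq_singleton_iff_unique_mem.mpr ⟨hl, fun p hp => ?_⟩⟩
  by_contra hne
  have := h2 p hp _ hl (lt_of_le_of_ne (Fin.le_last p) hne)
  rw [addFixed_last] at this
  exact absurd this (not_lt.mpr (Fin.le_last _))

lemma hasNest_addFixed_zero_one {n : ℕ} (f : Fin n → Fin n) : HasNest (addFixed f) 0 1 n := by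
  refine ⟨{Fin.last n}, rfl, ?_, ?_⟩
  · simp [addFixed_last]
  · simp

lemma hasNest_addArc_of_hasNest {n : ℕ} {k : Fin (n + 1)} {f : Fin n → Fin n} {ε j lo : ℕ}
    (h : HasNest f ε j (if lo ≤ k then lo else lo - 1)) : HasNest (addArc k f) ε j lo := by
  obtain ⟨C, hC, h1, h2⟩ := h
  refine ⟨C.map (insEmb k).toEmbedding, by rw [Finset.card_map, hC], ?_, ?_⟩
  · simp only [Finset.mem_map, RelEmbedding.coe_toEmbedding, forall_exists_index, and_imp]
    rintro _ p hp rfl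
    have := h1 p hp
    rw [addArc_insEmb, insEmb_val, insEmb_val]
    split_ifs at this ⊢ <;> omega
  · simp only [Finset.mem_map, RelEmbedding.coe_toEmbedding, forall_exists_index, and_imp]
    rintro _ p hp rfl _ q hq rfl hpq
    rw [addArc_insEmb, addArc_insEmb, OrderEmbedding.lt_iff_lt]
    exact h2 p hp q hq ((insEmb k).lt_iff_lt.mp hpq)

lemma hasNest_addArc_succ_of_hasNest {n : ℕ} {k : Fin (n + 1)} {f : Fin n → Fin n}
    {ε j lo : ℕ} (hε : ε ≤ 1) (hlo : lo ≤ k) (h : HasNest f ε j k) :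
    HasNest (addArc k f) ε (j + 1) lo := by
  obtain ⟨C, hC, h1, h2⟩ := h
  have hk : ∀ p ∈ C, k.castSucc < insEmb k p := by
    intro p hp
    have := h1 p hp
    rw [Fin.lt_def, insEmb_val, Fin.val_castSucc]
    split_ifs <;> omega
  refine ⟨insert k.castSucc (C.map (insEmb k).toEmbedding), ?_, ?_, ?_⟩
  · rw [Finset.card_insert_of_notMem, Finset.card_map, hC]
    simp only [Finset.mem_map, RelEmbedding.coe_toEmbedding, not_exists, not_and]
    exact fun p hp => (hk p hp).ne'
  · simp only [Finset.mem_insert, Finset.mem_map, RelEmbedding.coe_toEmbedding]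
    rintro _ (rfl | ⟨p, hp, rfl⟩)
    · rw [addArc_castSucc, Fin.val_castSucc, Fin.val_last]
      omega
    · have := h1 p hp
      rw [addArc_insEmb, insEmb_val, insEmb_val]
      split_ifs <;> omega
  · simp only [Finset.mem_insert, Finset.mem_map, RelEmbedding.coe_toEmbedding]
    rintro _ (rfl | ⟨p, hp, rfl⟩) _ (rfl | ⟨q, hq, rfl⟩) hpq
    · exact absurd hpq (lt_irrefl _)
    · rw [addArc_insEmb, addArc_castSucc, insEmb_apply]
      exact Fin.castSucc_lt_last _
    · exact absurd hpq (hk p hp).le.not_gt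
    · rw [addArc_insEmb, addArc_insEmb, OrderEmbedding.lt_iff_lt]
      exact h2 p hp q hq ((insEmb k).lt_iff_lt.mp hpq)

lemma exists_map_insEmb {n : ℕ} {k : Fin (n + 1)} {D : Finset (Fin (n + 2))}
    (h1 : Fin.last (n + 1) ∉ D) (h2 : k.castSucc ∉ D) :
    ∃ C : Finset (Fin n), D = C.map (insEmb k).toEmbedding := by
  refine ⟨Finset.univ.filter (fun i => insEmb k i ∈ D), ?_⟩
  ext p
  simp only [Finset.mem_map, Finset.mem_filter, Finset.mem_univ, true_and,
    RelEmbedding.coe_toEmbedding]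
  constructor
  · intro hp
    rcases insEmb_cases k p with rfl | rfl | ⟨i, rfl⟩
    · exact absurd hp h1
    · exact absurd hp h2
    · exact ⟨i, hp, rfl⟩
  · rintro ⟨i, hi, rfl⟩
    exact hi

lemma hasNest_addArc {n : ℕ} (k : Fin (n + 1)) (f : Fin n → Fin n) {ε : ℕ} (hε : ε ≤ 1)
    (j lo : ℕ) :
    HasNest (addArc k f) ε (j + 1) lo ↔
      HasNest f ε (j + 1) (if lo ≤ k then lo else lo - 1) ∨ (lo ≤ k ∧ HasNest f ε j k) := by
  constructor
  · rintro ⟨D, hD, h1, h2⟩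
    have hlast : Fin.last (n + 1) ∉ D := by
      intro hl
      have := (h1 _ hl).2
      rw [addArc_last, Fin.val_castSucc, Fin.val_last] at this
      omega
    by_cases hk : k.castSucc ∈ D
    · right
      have hklo : lo ≤ k := by simpa using (h1 _ hk).1
      refine ⟨hklo, ?_⟩
      obtain ⟨C, hC⟩ := exists_map_insEmb (k := k) (D := D.erase k.castSucc)
        (fun h => hlast (Finset.mem_of_mem_erase h)) (Finset.notMem_erase _ _)
      have hmem : ∀ p ∈ C, insEmb k p ∈ D := fun p hp =>
        Finset.mem_of_mem_erase (hC ▸ Finset.mem_map_of_mem _ hp)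
      refine ⟨C, ?_, ?_, ?_⟩
      · have h3 := Finset.card_erase_of_mem hk
        rw [hC, Finset.card_map] at h3
        omega
      · intro p hp
        have h3 := (h1 _ (hmem p hp)).2
        have h4 : ¬ insEmb k p < k.castSucc := by
          intro hlt
          have := h2 _ (hmem p hp) _ hk hlt
          rw [addArc_castSucc] at this
          exact absurd this (not_lt.mpr (Fin.le_last _))
        rw [Fin.lt_def, insEmb_val, Fin.val_castSucc] at h4
        rw [addArc_insEmb, insEmb_val, insEmb_val] at h3
        split_ifs at h3 h4 <;> omega
      · intro p hp q hq hpq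
        have h3 := h2 _ (hmem p hp) _ (hmem q hq) ((insEmb k).lt_iff_lt.mpr hpq)
        rwa [addArc_insEmb, addArc_insEmb, OrderEmbedding.lt_iff_lt] at h3
    · left
      obtain ⟨C, rfl⟩ := exists_map_insEmb hlast hk
      refine ⟨C, by rw [← hD, Finset.card_map], ?_, ?_⟩
      · intro p hp
        have h3 := h1 _ (Finset.mem_map_of_mem _ hp)
        rw [RelEmbedding.coe_toEmbedding, addArc_insEmb, insEmb_val, insEmb_val] at h3
        split_ifs at h3 ⊢ <;> omega
      · intro p hp q hq hpq
        have h3 := h2 _ (Finset.mem_map_of_mem _ hp) _ (Finset.mem_map_of_mem _ hq)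
          ((insEmb k).lt_iff_lt.mpr hpq)
        rwa [RelEmbedding.coe_toEmbedding, addArc_insEmb, addArc_insEmb,
          OrderEmbedding.lt_iff_lt] at h3
  · rintro (h | ⟨hlo, h⟩)
    · exact hasNest_addArc_of_hasNest h
    · exact hasNest_addArc_succ_of_hasNest hε hlo h

lemma label_addFixed_one {n : ℕ} (f : Fin n → Fin n) (j : ℕ) :
    label (addFixed f) 1 (j + 1) = label f 1 (j + 1) + 1 := by
  have hle := label_le f 1 (j + 1)
  refine label_eq_of_forall _ _ _ _ (by omega) fun i hi => ?_
  rw [hasNest_addFixed_one]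
  rcases hi.lt_or_eq with hi | rfl
  · rw [← add_label_lt_iff f 1 (j + 1) (by omega)]
    omega
  · constructor
    · intro h
      omega
    · intro h
      have := h.lt (by omega)
      omega

lemma label_addFixed_zero {n : ℕ} (f : Fin n → Fin n) (j : ℕ) :
    label (addFixed f) 0 (j + 1 + 1) = label f 0 (j + 1 + 1) + 1 := by
  have hle := label_le f 0 (j + 1 + 1)
  refine label_eq_of_forall _ _ _ _ (by omega) fun i hi => ?_
  rw [hasNest_addFixed_zero _ _ _ (by omega)]
  rcases hi.lt_or_eq with hi | rfl
  · rw [← add_label_lt_iff f 0 (j + 1 + 1) (by omega)]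
    omega
  · constructor
    · intro h
      omega
    · intro h
      have := h.lt (by omega)
      omega

lemma label_addFixed_zero_one {n : ℕ} (f : Fin n → Fin n) : label (addFixed f) 0 1 = 1 := by
  refine label_eq_of_forall _ _ _ _ (by omega) fun i hi => ?_
  constructor
  · intro h
    exact (hasNest_addFixed_zero_one f).of_le le_rfl (by omega)
  · intro h
    have := h.lt le_rfl
    omega

lemma label_addArc {n : ℕ} (k : Fin (n + 1)) (f : Fin n → Fin n) {ε : ℕ} (hε : ε ≤ 1) (j : ℕ) :
    label (addArc k f) ε (j + 1) =
      if label f ε (j + 1) ≤ n - k then label f ε (j + 1) + 1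
      else if label f ε j ≤ n - k then n - k + 2 else label f ε (j + 1) + 2 := by
  have hle := label_le f ε (j + 1)
  have hm := label_mono f ε (Nat.le_succ j)
  have hp := label_pos f ε j
  have hk := k.2
  refine label_eq_of_forall _ _ _ _ (by split_ifs <;> omega) fun i hi => ?_
  rw [hasNest_addArc k f hε, ← add_label_lt_iff f ε j (by omega)]
  by_cases hin : (if i ≤ k then i else i - 1) ≤ n
  · rw [← add_label_lt_iff f ε (j + 1) hin]
    simp only [Nat.succ_eq_add_one] at hm
    split_ifs <;> omega
  · have hn : ¬ HasNest f ε (j + 1) (if i ≤ k then i else i - 1) := by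
      intro h
      have := h.lt (by omega)
      omega
    simp only [hn, false_or]
    split_ifs at hin ⊢ <;> omega

lemma not_hasNest_addArc {n : ℕ} (k : Fin (n + 1)) (f : Fin n → Fin n) {ε : ℕ} (hε : ε ≤ 1)
    (ℓ : ℕ) :
    ¬ HasNest (addArc k f) ε (ℓ + 1) 0 ↔
      ¬ HasNest f ε (ℓ + 1) 0 ∧ n - k < label f ε ℓ := by
  have hk := k.2
  rw [hasNest_addArc k f hε, ← add_label_lt_iff f ε ℓ (by omega : (k : ℕ) ≤ n)]
  simp only [Nat.zero_le, if_true, true_and, not_or]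
  refine and_congr_right fun _ => ?_
  omega

lemma involutive_addFixed_iff {n : ℕ} (f : Fin n → Fin n) :
    Function.Involutive (addFixed f) ↔ Function.Involutive f := by
  constructor
  · intro h i
    have := h i.castSucc
    rwa [addFixed_castSucc, addFixed_castSucc, Fin.castSucc_inj] at this
  · intro h p
    induction p using Fin.lastCases with
    | last => rw [addFixed_last, addFixed_last]
    | cast p => rw [addFixed_castSucc, addFixed_castSucc, h]

lemma addFixed_injective {n : ℕ} : Function.Injective (addFixed (n := n)) := by
  intro f g h
  ext1 i
  have := congrFun h i.castSucc
  rwa [addFixed_castSucc, addFixed_castSucc, Fin.castSucc_inj] at this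

lemma exists_eq_addFixed {n : ℕ} {f : Fin (n + 1) → Fin (n + 1)} (hf : Function.Involutive f)
    (hl : f (Fin.last n) = Fin.last n) : ∃ g, addFixed g = f := by
  have h : ∀ i : Fin n, ∃ j : Fin n, j.castSucc = f i.castSucc := by
    intro i
    refine Fin.exists_castSucc_eq.mpr fun h => ?_
    rw [← hl] at h
    exact (Fin.castSucc_lt_last i).ne (hf.injective h)
  choose g hg using h
  refine ⟨g, funext fun p => ?_⟩
  induction p using Fin.lastCases with
  | last => rw [addFixed_last, hl]
  | cast p => rw [addFixed_castSucc, hg]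

lemma involutive_addArc_iff {n : ℕ} (k : Fin (n + 1)) (f : Fin n → Fin n) :
    Function.Involutive (addArc k f) ↔ Function.Involutive f := by
  constructor
  · intro h i
    have := h (insEmb k i)
    rwa [addArc_insEmb, addArc_insEmb, (insEmb k).eq_iff_eq] at this
  · intro h p
    rcases insEmb_cases k p with rfl | rfl | ⟨i, rfl⟩
    · rw [addArc_last, addArc_castSucc]
    · rw [addArc_castSucc, addArc_last]
    · rw [addArc_insEmb, addArc_insEmb, h]

lemma addArc_injective {n : ℕ} (k : Fin (n + 1)) : Function.Injective (addArc k) := by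
  intro f g h
  ext1 i
  have := congrFun h (insEmb k i)
  rwa [addArc_insEmb, addArc_insEmb, (insEmb k).eq_iff_eq] at this

lemma exists_eq_addArc {n : ℕ} {k : Fin (n + 1)} {f : Fin (n + 2) → Fin (n + 2)}
    (hf : Function.Involutive f) (hl : f (Fin.last (n + 1)) = k.castSucc) :
    ∃ g, addArc k g = f := by
  have hk : f k.castSucc = Fin.last (n + 1) := by rw [← hl, hf]
  have h : ∀ i : Fin n, ∃ j : Fin n, f (insEmb k i) = insEmb k j := by
    intro i
    rcases insEmb_cases k (f (insEmb k i)) with h | h | h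
    · rw [← hk] at h
      have := hf.injective h
      rw [insEmb_apply, Fin.castSucc_inj] at this
      exact absurd this (Fin.succAbove_ne k i)
    · rw [← hl] at h
      exact absurd (hf.injective h) (Fin.castSucc_lt_last _).ne
    · exact h
  choose g hg using h
  refine ⟨g, funext fun p => ?_⟩
  rcases insEmb_cases k p with rfl | rfl | ⟨i, rfl⟩
  · rw [addArc_last, hl]
  · rw [addArc_castSucc, hk]
  · rw [addArc_insEmb, hg]

/-- The involutions of `Fin n` (as functions) with no `ℓ + 1` nested arcs. -/
def nestFree (ℓ ε n : ℕ) : Finset (Fin n → Fin n) :=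
  Finset.univ.filter fun f => Function.Involutive f ∧ ¬ HasNest f ε (ℓ + 1) 0

lemma mem_nestFree {ℓ ε n : ℕ} {f : Fin n → Fin n} :
    f ∈ nestFree ℓ ε n ↔ Function.Involutive f ∧ ¬ HasNest f ε (ℓ + 1) 0 := by
  simp [nestFree]

section Sums

variable {M : Type*} [AddCommMonoid M]

lemma sum_nestFree_last {ℓ ε : ℕ} (hl : 1 ≤ ℓ) (hε : ε ≤ 1) (n : ℕ)
    (w : (Fin (n + 1) → Fin (n + 1)) → M) :
    ∑ f ∈ (nestFree ℓ ε (n + 1)).filter (fun f => f (Fin.last n) = Fin.last n), w f =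
      ∑ f ∈ nestFree ℓ ε n, w (addFixed f) := by
  have hnest : ∀ f : Fin n → Fin n,
      HasNest (addFixed f) ε (ℓ + 1) 0 ↔ HasNest f ε (ℓ + 1) 0 := by
    intro f
    rcases Nat.le_one_iff_eq_zero_or_eq_one.mp hε with rfl | rfl
    · exact hasNest_addFixed_zero f _ _ (by omega)
    · exact hasNest_addFixed_one f _ _
  symm
  refine Finset.sum_bij (fun f _ => addFixed f) ?_ ?_ ?_ fun _ _ => rfl
  · intro f hf
    rw [mem_nestFree] at hf
    rw [Finset.mem_filter, mem_nestFree, involutive_addFixed_iff, hnest]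
    exact ⟨hf, addFixed_last f⟩
  · intro f _ g _ h
    exact addFixed_injective h
  · intro f hf
    rw [Finset.mem_filter, mem_nestFree] at hf
    obtain ⟨g, rfl⟩ := exists_eq_addFixed hf.1.1 hf.2
    rw [involutive_addFixed_iff, hnest] at hf
    exact ⟨g, mem_nestFree.mpr hf.1, rfl⟩

lemma sum_nestFree_castSucc {ℓ ε : ℕ} (hε : ε ≤ 1) (n : ℕ) (k : Fin (n + 1))
    (w : (Fin (n + 2) → Fin (n + 2)) → M) :
    ∑ f ∈ (nestFree ℓ ε (n + 2)).filter (fun f => f (Fin.last (n + 1)) = k.castSucc), w f =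
      ∑ f ∈ nestFree ℓ ε n, if n - k < label f ε ℓ then w (addArc k f) else 0 := by
  rw [← Finset.sum_filter]
  symm
  refine Finset.sum_bij (fun f _ => addArc k f) ?_ ?_ ?_ fun _ _ => rfl
  · intro f hf
    rw [Finset.mem_filter, mem_nestFree] at hf
    rw [Finset.mem_filter, mem_nestFree, involutive_addArc_iff, not_hasNest_addArc k f hε]
    exact ⟨⟨hf.1.1, hf.1.2, hf.2⟩, addArc_last k f⟩
  · intro f _ g _ h
    exact addArc_injective k h
  · intro f hf
    rw [Finset.mem_filter, mem_nestFree] at hf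
    obtain ⟨g, rfl⟩ := exists_eq_addArc hf.1.1 hf.2
    rw [involutive_addArc_iff, not_hasNest_addArc k g hε] at hf
    exact ⟨g, Finset.mem_filter.mpr ⟨mem_nestFree.mpr ⟨hf.1.1, hf.1.2.1⟩, hf.1.2.2⟩, rfl⟩

lemma sum_nestFree_one {ℓ ε : ℕ} (hl : 1 ≤ ℓ) (hε : ε ≤ 1) (w : (Fin 1 → Fin 1) → M) :
    ∑ f ∈ nestFree ℓ ε 1, w f = ∑ f ∈ nestFree ℓ ε 0, w (addFixed f) := by
  rw [← sum_nestFree_last hl hε 0 w, Finset.filter_true_of_mem]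
  intro f _
  exact Subsingleton.elim (α := Fin 1) _ _

lemma sum_nestFree_add_two {ℓ ε : ℕ} (hl : 1 ≤ ℓ) (hε : ε ≤ 1) (n : ℕ)
    (w : (Fin (n + 2) → Fin (n + 2)) → M) :
    ∑ f ∈ nestFree ℓ ε (n + 2), w f =
      ∑ f ∈ nestFree ℓ ε (n + 1), w (addFixed f) +
      ∑ f ∈ nestFree ℓ ε n, ∑ k : Fin (n + 1),
        if n - k < label f ε ℓ then w (addArc k f) else 0 := by
  rw [← sum_nestFree_last hl hε (n + 1) w, Finset.sum_comm,
    ← Finset.sum_fiberwise (nestFree ℓ ε (n + 2)) (fun f => f (Fin.last (n + 1))) w,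
    Fin.sum_univ_castSucc, add_comm]
  congr 1
  exact Finset.sum_congr rfl fun k _ => sum_nestFree_castSucc hε n k w

lemma sum_range_eq_sum_blocks {a : ℕ → ℕ} (ha : Monotone a) (h0 : a 0 = 0) (ℓ : ℕ)
    (F : ℕ → M) :
    ∑ t ∈ Finset.range (a ℓ), F t =
      ∑ j ∈ Finset.range ℓ, ∑ s ∈ Finset.range (a (j + 1) - a j), F (a j + s) := by
  induction ℓ with
  | zero => simp [h0]
  | succ ℓ ih =>
    rw [Finset.sum_range_succ, ← ih, ← Finset.sum_range_add, Nat.add_sub_cancel' (ha ℓ.le_succ)]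

/-- The arc insertions into `f` are indexed by `t = n - k`, which runs over the blocks
`a_j ≤ t < a_{j+1}`. -/
lemma sum_ite_lt_label {n : ℕ} (f : Fin n → Fin n) (ε ℓ : ℕ) (F : ℕ → M) :
    (∑ k : Fin (n + 1), if n - (k : ℕ) < label f ε ℓ then F (n - k) else 0) =
      ∑ j ∈ Finset.range ℓ, ∑ s ∈ Finset.range (label f ε (j + 1) - label f ε j),
        F (label f ε j + s) := by
  rw [← sum_range_eq_sum_blocks (label_mono f ε) (label_zero f ε),
    Fin.sum_univ_eq_sum_range (fun k => if n - k < label f ε ℓ then F (n - k) else 0) (n + 1),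
    Finset.sum_flip (fun t => if t < label f ε ℓ then F t else 0), ← Finset.sum_filter]
  congr 1
  ext t
  have := label_le f ε ℓ
  simp only [Finset.mem_filter, Finset.mem_range]
  omega

end Sums

section Weights

variable {K : Type*} [Field K]

/-- The monomial `∏_j v_j^{a_{j+1} - a_j}`. -/
def weight (ℓ : ℕ) (a : ℕ → ℕ) (v : ℕ → K) : K :=
  ∏ j ∈ Finset.range (ℓ + 1), v j ^ (a (j + 1) - a j)

lemma weight_addFixed_one {n : ℕ} (f : Fin n → Fin n) (ℓ : ℕ) (v : ℕ → K) :
    weight ℓ (label (addFixed f) 1) v = v 0 * weight ℓ (label f 1) v := by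
  unfold weight
  rw [Finset.prod_range_succ', Finset.prod_range_succ', label_addFixed_one, label_zero,
    label_zero, Nat.sub_zero, Nat.sub_zero, pow_succ]
  have : ∀ j, label (addFixed f) 1 (j + 1 + 1) - label (addFixed f) 1 (j + 1) =
      label f 1 (j + 1 + 1) - label f 1 (j + 1) := by
    intro j
    rw [label_addFixed_one, label_addFixed_one]
    omega
  simp only [this]
  ring

lemma weight_addFixed_zero {n : ℕ} (f : Fin n → Fin n) (ℓ : ℕ) (v : ℕ → K) :
    weight (ℓ + 1) (label (addFixed f) 0) v =
      v 0 * weight (ℓ + 1) (label f 0) (Function.update v 0 (v 1)) := by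
  unfold weight
  rw [Finset.prod_range_succ', Finset.prod_range_succ', Finset.prod_range_succ',
    Finset.prod_range_succ', zero_add, label_addFixed_zero, label_addFixed_zero_one, label_zero,
    label_zero]
  have : ∀ j, label (addFixed f) 0 (j + 1 + 1 + 1) - label (addFixed f) 0 (j + 1 + 1) =
      label f 0 (j + 1 + 1 + 1) - label f 0 (j + 1 + 1) := by
    intro j
    rw [label_addFixed_zero, label_addFixed_zero]
    omega
  have h1 := label_mono f 0 (Nat.le_succ 1)
  have h2 : label f 0 (0 + 1 + 1) + 1 - 1 =
      (label f 0 (0 + 1 + 1) - label f 0 (0 + 1)) + label f 0 (0 + 1) := by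
    simp only [Nat.succ_eq_add_one, zero_add] at h1 ⊢
    omega
  simp only [this, h2, pow_add, Function.update_self, Nat.sub_zero]
  simp
  ring

lemma prod_eq_mul_mul_prod_erase {ℓ j : ℕ} (hj : j < ℓ) (F : ℕ → K) :
    ∏ i ∈ Finset.range (ℓ + 1), F i =
      F j * (F (j + 1) * ∏ i ∈ ((Finset.range (ℓ + 1)).erase j).erase (j + 1), F i) := by
  rw [Finset.mul_prod_erase _ _ (by simp; omega), Finset.mul_prod_erase _ _ (by simp; omega)]

lemma sub_eq_of_insertion {a b : ℕ → ℕ} (ha : Monotone a) (ha0 : a 0 = 0) (hb0 : b 0 = 0)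
    {j s : ℕ} (hs : s < a (j + 1) - a j)
    (hb : ∀ i, b (i + 1) =
      if a (i + 1) ≤ a j + s then a (i + 1) + 1
      else if a i ≤ a j + s then a j + s + 2 else a (i + 1) + 2) (i : ℕ) :
    b (i + 1) - b i = (if i = 0 then 1 else 0) + (if i = j then s + 1
      else if i = j + 1 then a (j + 2) - a (j + 1) + (a (j + 1) - a j - s)
      else a (i + 1) - a i) := by
  have low : ∀ i, i + 1 ≤ j → b (i + 1) = a (i + 1) + 1 := by
    intro i hi
    have := ha hi
    rw [hb, if_pos (by omega)]
  have mid : b (j + 1) = a j + s + 2 := by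
    rw [hb, if_neg (by omega), if_pos (by omega)]
  have high : ∀ i, j + 1 ≤ i → b (i + 1) = a (i + 1) + 2 := by
    intro i hi
    have h1 := ha hi
    have h2 := ha (Nat.le_succ i)
    rw [Nat.succ_eq_add_one] at h2
    rw [hb, if_neg (by omega), if_neg (by omega)]
  rcases i with _ | i
  · rcases Nat.eq_zero_or_pos j with rfl | hj
    · simp only [mid, hb0, ha0, if_true]
      omega
    · rw [low 0 hj, hb0, ha0, if_pos rfl, if_neg hj.ne, if_neg (by omega)]
      omega
  · rw [if_neg (by omega : i + 1 ≠ 0), zero_add]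
    rcases lt_trichotomy (i + 1) j with h | rfl | h
    · rw [low i h.le, low (i + 1) h, if_neg h.ne, if_neg (by omega)]
      omega
    · rw [mid, low i le_rfl, if_pos rfl]
      omega
    · rw [if_neg h.ne']
      rcases (show j ≤ i by omega).eq_or_lt with rfl | h1
      · have := ha (Nat.le_succ (j + 1))
        rw [Nat.succ_eq_add_one] at this
        rw [if_pos rfl, high (j + 1) le_rfl, mid]
        change _ = a (j + 1 + 1) - _ + _
        omega
      · rw [high i h1, high (i + 1) (by omega), if_neg (by omega)]
        omega

lemma weight_addArc {n : ℕ} (k : Fin (n + 1)) (f : Fin n → Fin n) {ε : ℕ} (hε : ε ≤ 1)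
    {ℓ j s : ℕ} (v : ℕ → K) (hs : s < label f ε (j + 1) - label f ε j)
    (hk : n - k = label f ε j + s) :
    weight ℓ (label (addArc k f) ε) v =
      v 0 * ∏ i ∈ Finset.range (ℓ + 1), v i ^
        (if i = j then s + 1
          else if i = j + 1 then
            label f ε (j + 2) - label f ε (j + 1) + (label f ε (j + 1) - label f ε j - s)
          else label f ε (i + 1) - label f ε i) := by
  have key := sub_eq_of_insertion (label_mono f ε) (label_zero f ε)
    (label_zero (addArc k f) ε) hs fun i => by rw [label_addArc k f hε, hk]
  unfold weight
  simp only [key, pow_add _ (ite _ 1 0)]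
  rw [Finset.prod_mul_distrib]
  congr 1
  rw [Finset.prod_eq_single 0]
  · simp
  · intro i _ hi
    simp [hi]
  · simp

lemma sum_block {a : ℕ → ℕ} {ℓ j : ℕ} (hj : j < ℓ) (v : ℕ → K) (hv : v j ≠ v (j + 1)) :
    ∑ s ∈ Finset.range (a (j + 1) - a j), ∏ i ∈ Finset.range (ℓ + 1), v i ^
        (if i = j then s + 1
          else if i = j + 1 then a (j + 2) - a (j + 1) + (a (j + 1) - a j - s)
          else a (i + 1) - a i) =
      v j * v (j + 1) *
        ((weight ℓ a v - weight ℓ a (Function.update v j (v (j + 1)))) / (v j - v (j + 1))) := by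
  set R := ∏ i ∈ ((Finset.range (ℓ + 1)).erase j).erase (j + 1), v i ^ (a (i + 1) - a i) with hR
  have hmem : ∀ i ∈ ((Finset.range (ℓ + 1)).erase j).erase (j + 1), i ≠ j ∧ i ≠ j + 1 := by
    intro i hi
    simp only [Finset.mem_erase] at hi
    exact ⟨hi.2.1, hi.1⟩
  set d := a (j + 1) - a j with hd
  set d' := a (j + 2) - a (j + 1) with hd'
  have h1 : weight ℓ a v = v j ^ d * (v (j + 1) ^ d' * R) :=
    prod_eq_mul_mul_prod_erase hj _
  have h2 : weight ℓ a (Function.update v j (v (j + 1))) =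
      v (j + 1) ^ d * (v (j + 1) ^ d' * R) := by
    unfold weight
    rw [prod_eq_mul_mul_prod_erase hj, Function.update_self,
      Function.update_of_ne (by omega : j + 1 ≠ j), hR]
    congr 2
    refine Finset.prod_congr rfl fun i hi => ?_
    rw [Function.update_of_ne (hmem i hi).1]
  have h3 : ∀ s ∈ Finset.range d, ∏ i ∈ Finset.range (ℓ + 1), v i ^
        (if i = j then s + 1 else if i = j + 1 then d' + (d - s) else a (i + 1) - a i) =
      v j * v (j + 1) * (v (j + 1) ^ d' * R) * (v j ^ s * v (j + 1) ^ (d - 1 - s)) := by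
    intro s hs
    rw [prod_eq_mul_mul_prod_erase hj, if_pos rfl, if_neg (by omega : j + 1 ≠ j), if_pos rfl]
    have : ∏ i ∈ ((Finset.range (ℓ + 1)).erase j).erase (j + 1), v i ^
        (if i = j then s + 1 else if i = j + 1 then d' + (d - s) else a (i + 1) - a i) = R := by
      refine Finset.prod_congr rfl fun i hi => ?_
      rw [if_neg (hmem i hi).1, if_neg (hmem i hi).2]
    rw [this, show d - s = d - 1 - s + 1 by have := Finset.mem_range.mp hs; omega]
    ring
  rw [Finset.sum_congr rfl h3, ← Finset.mul_sum, h1, h2, ← sub_mul, ← geom_sum₂_mul]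
  have := sub_ne_zero.mpr hv
  field_simp

/-- The generating function `G_n` evaluated at `v`. -/
def nestGF (ℓ ε n : ℕ) (v : ℕ → K) : K :=
  ∑ f ∈ nestFree ℓ ε n, weight ℓ (label f ε) v

lemma sum_weight_addFixed {ℓ ε : ℕ} (hl : 1 ≤ ℓ) (hε : ε ≤ 1) (n : ℕ) (v : ℕ → K) :
    ∑ f ∈ nestFree ℓ ε n, weight ℓ (label (addFixed f) ε) v =
      ε * v 0 * nestGF ℓ ε n v +
        (1 - ε) * v 0 * nestGF ℓ ε n (Function.update v 0 (v 1)) := by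
  obtain ⟨ℓ, rfl⟩ := Nat.exists_eq_add_of_le' hl
  unfold nestGF
  rcases Nat.le_one_iff_eq_zero_or_eq_one.mp hε with rfl | rfl
  · simp [weight_addFixed_zero, Finset.mul_sum]
  · simp [weight_addFixed_one, Finset.mul_sum]

lemma sum_weight_addArc {ℓ ε : ℕ} (hε : ε ≤ 1) {n : ℕ} (f : Fin n → Fin n) (v : ℕ → K)
    (hv : ∀ j < ℓ, v j ≠ v (j + 1)) :
    (∑ k : Fin (n + 1),
        if n - (k : ℕ) < label f ε ℓ then weight ℓ (label (addArc k f) ε) v else 0) =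
      v 0 * ∑ j ∈ Finset.range ℓ, v j * v (j + 1) *
        ((weight ℓ (label f ε) v - weight ℓ (label f ε) (Function.update v j (v (j + 1)))) /
          (v j - v (j + 1))) := by
  have h := sum_ite_lt_label f ε ℓ
    (fun t => weight ℓ (label (addArc (Fin.ofNat (n + 1) (n - t)) f) ε) v)
  have h1 : ∀ k : Fin (n + 1), Fin.ofNat (n + 1) (n - (n - (k : ℕ))) = k := by
    intro k
    have := k.2
    ext
    rw [Fin.val_ofNat, Nat.mod_eq_of_lt (by omega)]
    omega
  simp only [h1] at h
  rw [h, Finset.mul_sum]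
  refine Finset.sum_congr rfl fun j hj => ?_
  rw [Finset.mem_range] at hj
  rw [← sum_block hj v (hv j hj), Finset.mul_sum]
  refine Finset.sum_congr rfl fun s hs => ?_
  rw [Finset.mem_range] at hs
  refine weight_addArc _ f hε v hs ?_
  have := label_le f ε (j + 1)
  rw [Fin.val_ofNat, Nat.mod_eq_of_lt (by omega)]
  omega

lemma nestGF_one {ℓ ε : ℕ} (hl : 1 ≤ ℓ) (hε : ε ≤ 1) (v : ℕ → K) :
    nestGF ℓ ε 1 v =
      ε * v 0 * nestGF ℓ ε 0 v +
        (1 - ε) * v 0 * nestGF ℓ ε 0 (Function.update v 0 (v 1)) := by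
  rw [← sum_weight_addFixed hl hε]
  exact sum_nestFree_one hl hε fun f => weight ℓ (label f ε) v

lemma nestGF_add_two {ℓ ε : ℕ} (hl : 1 ≤ ℓ) (hε : ε ≤ 1) (n : ℕ) (v : ℕ → K)
    (hv : ∀ j < ℓ, v j ≠ v (j + 1)) :
    nestGF ℓ ε (n + 2) v =
      ε * v 0 * nestGF ℓ ε (n + 1) v +
        (1 - ε) * v 0 * nestGF ℓ ε (n + 1) (Function.update v 0 (v 1)) +
      v 0 * ∑ j ∈ Finset.range ℓ, v j * v (j + 1) *
        ((nestGF ℓ ε n v - nestGF ℓ ε n (Function.update v j (v (j + 1)))) /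
          (v j - v (j + 1))) := by
  rw [← sum_weight_addFixed hl hε]
  unfold nestGF
  rw [sum_nestFree_add_two hl hε]
  congr 1
  simp only [sum_weight_addArc hε _ v hv, ← Finset.mul_sum, Finset.sum_comm (s := nestFree ℓ ε n),
    ← Finset.sum_div, ← Finset.sum_sub_distrib]

end Weights

lemma map_Gpoly {K : Type*} [Field K] {ℓ ε : ℕ} (hε : ε ≤ 1) (n : ℕ)
    (φ : MvPolynomial (Fin ℓ) ℚ →+* K) (v : ℕ → K) (hφ : ∀ j : Fin ℓ, φ (MvPolynomial.X j) = v j)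
    (hv : v ℓ = 1) : φ (Gpoly ℓ ε n) = nestGF ℓ ε n v := by
  unfold Gpoly nestGF
  rw [map_sum]
  refine Finset.sum_bij (fun τ _ => ⇑τ) ?_ ?_ ?_ ?_
  · intro τ hτ
    rw [Finset.mem_filter] at hτ
    rw [mem_nestFree, ← hasDescSeq_iff_hasNest hτ.2.1 hε]
    exact hτ.2
  · intro τ _ σ _ h
    exact DFunLike.coe_injective h
  · intro f hf
    rw [mem_nestFree] at hf
    refine ⟨hf.1.toPerm f, ?_, rfl⟩
    rw [Finset.mem_filter, Function.Involutive.coe_toPerm, hasDescSeq_iff_hasNest hf.1 hε]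
    exact ⟨Finset.mem_univ _, hf⟩
  · intro τ _
    unfold weight
    rw [Finset.prod_range_succ, hv, one_pow, mul_one, map_prod,
      ← Fin.prod_univ_eq_prod_range (fun j => v j ^ (label τ ε (j + 1) - label τ ε j)) ℓ]
    refine Finset.prod_congr rfl fun j _ => ?_
    rw [map_pow, hφ]
    rfl

lemma Gpoly_zero {ℓ ε : ℕ} (hl : 0 < ℓ) (hε : ε ≤ 1) :
    Gpoly ℓ ε 0 = MvPolynomial.X ⟨0, hl⟩ := by
  have hb : ∀ f : Fin 0 → Fin 0, ∀ j, label f ε (j + 1) = 1 := fun f j =>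
    le_antisymm (label_le f ε (j + 1)) (label_pos f ε j)
  obtain ⟨ℓ, rfl⟩ := Nat.exists_eq_add_of_le' hl
  unfold Gpoly
  rw [Finset.sum_eq_single (1 : Equiv.Perm (Fin 0))]
  · rw [Fin.prod_univ_succ]
    have h1 : bStat (id : Fin 0 → Fin 0) ε 1 = 1 := hb _ 0
    have h2 : ∀ j, bStat (id : Fin 0 → Fin 0) ε (j + 1) = 1 := hb _
    simp [h1, h2]
  · intro τ _ h
    exact absurd (Subsingleton.elim _ _) h
  · intro h
    refine absurd (Finset.mem_filter.mpr ⟨Finset.mem_univ _, fun i => rfl, ?_⟩) h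
    rw [hasDescSeq_iff_hasNest (fun i => rfl) hε]
    intro h
    exact absurd (h.lt (by omega)) (lt_irrefl _)

/-- The variables `v_1, …, v_ℓ, 1, 1, …` in the field of rational functions. -/
def rfVar (ℓ j : ℕ) : RatFunField ℓ :=
  if h : j < ℓ then toRF (MvPolynomial.X ⟨j, h⟩) else 1

lemma toRF_injective (ℓ : ℕ) : Function.Injective (toRF (ℓ := ℓ)) :=
  IsFractionRing.injective _ _

lemma rfVar_ne {ℓ j : ℕ} (hj : j < ℓ) : rfVar ℓ j ≠ rfVar ℓ (j + 1) := by
  unfold rfVar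
  rw [dif_pos hj]
  split_ifs with h
  · intro he
    have := MvPolynomial.X_injective (toRF_injective ℓ he)
    simp at this
  · rw [← map_one (toRF (ℓ := ℓ))]
    intro he
    have h1 := congrArg (MvPolynomial.eval (fun _ => (0 : ℚ))) (toRF_injective ℓ he)
    simp at h1

lemma toRF_Gpoly {ℓ ε : ℕ} (hε : ε ≤ 1) (n : ℕ) :
    toRF (Gpoly ℓ ε n) = nestGF ℓ ε n (rfVar ℓ) :=
  map_Gpoly hε n toRF _ (fun j => by simp [rfVar]) (by simp [rfVar])

lemma toRF_aeval_Gpoly {ℓ ε : ℕ} (hε : ε ≤ 1) (n j : ℕ) (hj : j < ℓ)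
    (g : Fin ℓ → MvPolynomial (Fin ℓ) ℚ) (hg : toRF (g ⟨j, hj⟩) = rfVar ℓ (j + 1))
    (hg' : ∀ k, k ≠ ⟨j, hj⟩ → g k = MvPolynomial.X k) :
    toRF (MvPolynomial.aeval g (Gpoly ℓ ε n)) =
      nestGF ℓ ε n (Function.update (rfVar ℓ) j (rfVar ℓ (j + 1))) := by
  refine map_Gpoly hε n (toRF.comp (MvPolynomial.aeval g).toRingHom) _ (fun k => ?_) ?_
  · change toRF (MvPolynomial.aeval g (MvPolynomial.X k)) = _
    rw [MvPolynomial.aeval_X]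
    by_cases hk : k = ⟨j, hj⟩
    · subst hk
      rw [hg, Function.update_self]
    · rw [hg' k hk, Function.update_of_ne fun h => hk (Fin.ext h)]
      simp [rfVar]
  · rw [Function.update_of_ne hj.ne']
    simp [rfVar]

/-- The functional equation for involutions avoiding `(m+1)m⋯21`, `m = 2ℓ+ε`:
`G_0 = v_1` and, with `G_{−1} = 0` and the convention `v_{ℓ+1} = 1`,
`G_{n+1} = ε v_1 G_n + (1−ε) v_1 G_n|_{v_1←v_2}
 + v_1 ∑_{j=1}^ℓ v_j v_{j+1} (G_{n−1} − G_{n−1}|_{v_j←v_{j+1}})/(v_j − v_{j+1})`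
in the field of rational functions `ℚ(v_1,…,v_ℓ)`. -/
theorem functional_equation_inv (ℓ ε : ℕ) (hl : 1 ≤ ℓ) (hε : ε ≤ 1) :
    Gpoly ℓ ε 0 = MvPolynomial.X ⟨0, by omega⟩ ∧
    ∀ n : ℕ,
      toRF (Gpoly ℓ ε (n + 1))
        = (ε : RatFunField ℓ) * toRF (MvPolynomial.X ⟨0, by omega⟩) *
            toRF (Gpoly ℓ ε n)
          + ((1 : RatFunField ℓ) - (ε : RatFunField ℓ)) *
              toRF (MvPolynomial.X ⟨0, by omega⟩) *
              toRF (MvPolynomial.aeval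
                (fun k : Fin ℓ =>
                  if k = (⟨0, by omega⟩ : Fin ℓ) then
                    (if h : ℓ = 1 then 1 else MvPolynomial.X (⟨1, by omega⟩ : Fin ℓ))
                  else MvPolynomial.X k)
                (Gpoly ℓ ε n))
          + toRF (MvPolynomial.X ⟨0, by omega⟩) *
              ∑ j ∈ (Finset.Icc 1 ℓ).attach,
                toRF (MvPolynomial.X
                    (⟨j.1 - 1, by have := Finset.mem_Icc.mp j.2; omega⟩ : Fin ℓ)) *
                  (if h : j.1 = ℓ then 1
                    else toRF (MvPolynomial.X
                      (⟨j.1, by have := Finset.mem_Icc.mp j.2; omega⟩ : Fin ℓ))) *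
                  ((toRF (if n = 0 then 0 else Gpoly ℓ ε (n - 1))
                    - toRF (MvPolynomial.aeval
                        (fun k : Fin ℓ =>
                          if k = (⟨j.1 - 1, by have := Finset.mem_Icc.mp j.2; omega⟩ : Fin ℓ)
                          then
                            (if h : j.1 = ℓ then 1
                              else MvPolynomial.X
                                (⟨j.1, by have := Finset.mem_Icc.mp j.2; omega⟩ : Fin ℓ))
                          else MvPolynomial.X k)
                        (if n = 0 then 0 else Gpoly ℓ ε (n - 1))))
                    / (toRF (MvPolynomial.X
                          (⟨j.1 - 1, by have := Finset.mem_Icc.mp j.2; omega⟩ : Fin ℓ))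
                        - (if h : j.1 = ℓ then 1
                            else toRF (MvPolynomial.X
                              (⟨j.1, by have := Finset.mem_Icc.mp j.2; omega⟩ : Fin ℓ))))) := by
  refine ⟨Gpoly_zero hl hε, fun n => ?_⟩
  have hX : ∀ (j : ℕ) (h : j < ℓ), toRF (MvPolynomial.X (⟨j, h⟩ : Fin ℓ)) = rfVar ℓ j :=
    fun j h => by rw [rfVar, dif_pos h]
  have hsub : ∀ (j : ℕ) (h1 : 1 ≤ j) (h2 : j ≤ ℓ),
      toRF (if h : j = ℓ then 1 else MvPolynomial.X (⟨j, by omega⟩ : Fin ℓ)) = rfVar ℓ j := by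
    intro j h1 h2
    split_ifs with h
    · rw [map_one, rfVar, dif_neg (by omega)]
    · exact hX _ _
  have hval : ∀ (j : ℕ) (h1 : 1 ≤ j) (h2 : j ≤ ℓ),
      (if h : j = ℓ then 1 else toRF (MvPolynomial.X (⟨j, by omega⟩ : Fin ℓ))) = rfVar ℓ j := by
    intro j h1 h2
    split_ifs with h
    · rw [rfVar, dif_neg (by omega)]
    · exact hX _ _
  rw [toRF_Gpoly hε, toRF_Gpoly hε, hX,
    toRF_aeval_Gpoly hε n 0 (by omega) _
      (by simpa [eq_comm] using hsub 1 le_rfl hl) (fun k hk => by rw [if_neg hk])]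
  rcases n with _ | n
  · simp [nestGF_one hl hε]
  · rw [nestGF_add_two hl hε n (rfVar ℓ) fun j hj => rfVar_ne hj]
    congr 2
    simp only [Nat.add_one_ne_zero, if_false, Nat.add_sub_cancel]
    have hterm : ∀ j ∈ Finset.Icc 1 ℓ, j - 1 < ℓ ∧ j - 1 + 1 = j ∧ 1 ≤ j ∧ j ≤ ℓ := by
      intro j hj
      rw [Finset.mem_Icc] at hj
      omega
    rw [Finset.sum_bij' (s := Finset.range ℓ) (t := (Finset.Icc 1 ℓ).attach)
      (fun j hj => ⟨j + 1, by rw [Finset.mem_range] at hj; rw [Finset.mem_Icc]; omega⟩)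
      (fun j _ => j.1 - 1) (fun _ _ => Finset.mem_attach _ _)
      (fun j _ => Finset.mem_range.mpr (hterm j.1 j.2).1) (fun j _ => Nat.add_sub_cancel j 1)
      (fun j _ => Subtype.ext (hterm j.1 j.2).2.1)]
    intro j hj
    rw [Finset.mem_range] at hj
    simp only [Nat.add_sub_cancel, hX j hj]
    rw [hval (j + 1) (by omega) hj, toRF_Gpoly hε,
      toRF_aeval_Gpoly hε n j hj _ ((congrArg toRF (if_pos rfl)).trans (hsub (j + 1) (by omega) hj))
        (fun k hk => if_neg hk)]
end
end

section
/- (MacMahon's formula.) Let m ≥ 1 and let λ = (λ_1, …, λ_m) with λ_1 ≥ ⋯ ≥ λ_m ≥ 0 be an integer partition of weight n = λ_1 + ⋯ + λ_m. Then the number f^λ of standard Young tableaux of shape λ satisfies f^λ · ∏_{i=1}^m (λ_i − i + m)! = n! · ∏_{1≤i<j≤m} (λ_i − λ_j − i + j). (Note λ_i − i + m ≥ 0 for all i, so all factorials are factorials of natural numbers.) -/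
open scoped Classical

noncomputable section

/-- The number `f^λ` of standard Young tableaux of shape `λ = (lam 0 ≥ ⋯ ≥ lam (m-1))`:
fillings `T` of the cells `{(i,j) : j < lam i}` that biject onto `{1,…,n}`
(`n = ∑ lam i`), strictly increase along rows and columns, and (for
normalization) vanish outside the cells. -/
def sytCount (m : ℕ) (lam : Fin m → ℕ) : ℕ :=
  Nat.card {T : Fin m → ℕ → ℕ //
    Set.BijOn (fun p : Fin m × ℕ => T p.1 p.2)
      {p : Fin m × ℕ | p.2 < lam p.1} (Set.Icc 1 (∑ i, lam i)) ∧
    (∀ i : Fin m, ∀ j₁ j₂ : ℕ, j₁ < j₂ → j₂ < lam i → T i j₁ < T i j₂) ∧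
    (∀ i₁ i₂ : Fin m, ∀ j : ℕ, i₁ < i₂ → j < lam i₂ → T i₁ j < T i₂ j) ∧
    (∀ i : Fin m, ∀ j : ℕ, lam i ≤ j → T i j = 0)}

/-- The fillings counted by `sytCount`. -/
def IsSYT {m : ℕ} (lam : Fin m → ℕ) (T : Fin m → ℕ → ℕ) : Prop :=
  Set.BijOn (fun p : Fin m × ℕ => T p.1 p.2)
    {p : Fin m × ℕ | p.2 < lam p.1} (Set.Icc 1 (∑ i, lam i)) ∧
  (∀ i : Fin m, ∀ j₁ j₂ : ℕ, j₁ < j₂ → j₂ < lam i → T i j₁ < T i j₂) ∧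
  (∀ i₁ i₂ : Fin m, ∀ j : ℕ, i₁ < i₂ → j < lam i₂ → T i₁ j < T i₂ j) ∧
  (∀ i : Fin m, ∀ j : ℕ, lam i ≤ j → T i j = 0)

theorem sytCount_eq_card {m : ℕ} (lam : Fin m → ℕ) :
    sytCount m lam = Nat.card {T // IsSYT lam T} := rfl

/-- `T` with the entry of the cell `(i, j)` replaced by `v`. -/
def setCell {m : ℕ} (T : Fin m → ℕ → ℕ) (i : Fin m) (j v : ℕ) : Fin m → ℕ → ℕ :=
  fun a b => if a = i ∧ b = j then v else T a b

/-- `lam` with one cell removed from row `i`. -/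
def removeCell {m : ℕ} (lam : Fin m → ℕ) (i : Fin m) : Fin m → ℕ :=
  Function.update lam i (lam i - 1)

section Tableaux

variable {m : ℕ} {lam : Fin m → ℕ} {T : Fin m → ℕ → ℕ} {i : Fin m}

theorem removeCell_self : removeCell lam i i = lam i - 1 := by simp [removeCell]

theorem removeCell_of_ne {a : Fin m} (h : a ≠ i) : removeCell lam i a = lam a := by
  simp [removeCell, h]

theorem sum_removeCell (hi : 0 < lam i) : ∑ a, removeCell lam i a + 1 = ∑ a, lam a := by
  unfold removeCell
  rw [Finset.sum_update_of_mem (Finset.mem_univ i),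
    ← Finset.add_sum_erase _ _ (Finset.mem_univ i), Finset.sdiff_singleton_eq_erase]
  omega

theorem lt_removeCell_iff (hi : 0 < lam i) (p : Fin m × ℕ) :
    p.2 < removeCell lam i p.1 ↔ p.2 < lam p.1 ∧ p ≠ (i, lam i - 1) := by
  obtain ⟨a, b⟩ := p
  by_cases h : a = i
  · subst h
    simp only [removeCell_self, ne_eq, Prod.mk.injEq, true_and]
    omega
  · simp [removeCell_of_ne h, h]

theorem cells_removeCell (hi : 0 < lam i) :
    {p : Fin m × ℕ | p.2 < removeCell lam i p.1} =
      {p : Fin m × ℕ | p.2 < lam p.1} \ {(i, lam i - 1)} := by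
  ext p
  simp [lt_removeCell_iff hi]

theorem IsSYT.le_sum (hT : IsSYT lam T) (a : Fin m) (b : ℕ) : T a b ≤ ∑ i, lam i := by
  rcases lt_or_ge b (lam a) with h | h
  · exact (hT.1.mapsTo (show (a, b) ∈ {p : Fin m × ℕ | p.2 < lam p.1} from h)).2
  · simp [hT.2.2.2 a b h]

instance finite_isSYT : Finite {T : Fin m → ℕ → ℕ // IsSYT lam T} := by
  refine Finite.of_injective
    (β := Fin m → Fin (∑ i, lam i) → Fin (∑ i, lam i + 1))
    (fun T a b => ⟨T.1 a b, Nat.lt_succ_of_le (T.2.le_sum a b)⟩) ?_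
  intro T T' h
  ext a b
  rcases lt_or_ge b (∑ i, lam i) with hb | hb
  · exact congrArg Fin.val (congrFun (congrFun h a) ⟨b, hb⟩)
  · have : lam a ≤ b :=
      (Finset.single_le_sum (f := lam) (fun _ _ => Nat.zero_le _) (Finset.mem_univ a)).trans hb
    rw [T.2.2.2.2 a b this, T'.2.2.2.2 a b this]

theorem IsSYT.setCell_zero (hT : IsSYT lam T) (hi : 0 < lam i)
    (hmax : T i (lam i - 1) = ∑ a, lam a) :
    IsSYT (removeCell lam i) (setCell T i (lam i - 1) 0) := by
  have hlt := lt_removeCell_iff (lam := lam) hi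
  have hne : ∀ a b, b < removeCell lam i a → setCell T i (lam i - 1) 0 a b = T a b := by
    intro a b hab
    have := ((hlt (a, b)).1 hab).2
    simp only [ne_eq, Prod.mk.injEq] at this
    simp [setCell, this]
  have hle : ∀ a, removeCell lam i a ≤ lam a := by
    intro a
    by_cases h : a = i
    · subst h; simp [removeCell_self]
    · simp [removeCell_of_ne h]
  have hcol : ∀ i₁ i₂ : Fin m, ∀ j, i₁ < i₂ → j < removeCell lam i i₂ →
      (i₁, j) ≠ (i, lam i - 1) := by
    intro i₁ i₂ j h hj heq
    obtain ⟨rfl, rfl⟩ := Prod.mk.inj heq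
    have h1 := hT.2.2.1 _ i₂ _ h (hj.trans_le (hle i₂))
    have h2 := hT.le_sum i₂ (lam i₁ - 1)
    omega
  refine ⟨?_, ?_, ?_, ?_⟩
  · have h := hT.1.sdiff_singleton (a := (i, lam i - 1))
      (show lam i - 1 < lam i by omega)
    rw [← cells_removeCell hi] at h
    have hset : Set.Icc 1 (∑ a, lam a) \ {T i (lam i - 1)} =
        Set.Icc 1 (∑ a, removeCell lam i a) := by
      have := sum_removeCell hi
      ext k
      simp only [hmax, Set.mem_sdiff, Set.mem_Icc, Set.mem_singleton_iff]
      omega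
    simp only [hset] at h
    exact h.congr fun p hp => (hne p.1 p.2 hp).symm
  · intro a j₁ j₂ h h₂
    rw [hne a j₁ (h.trans h₂), hne a j₂ h₂]
    exact hT.2.1 a j₁ j₂ h (h₂.trans_le (hle a))
  · intro i₁ i₂ j h hj
    have := hcol i₁ i₂ j h hj
    rw [hne i₂ j hj]
    simp only [ne_eq, Prod.mk.injEq] at this
    simp only [setCell, this, if_false]
    exact hT.2.2.1 i₁ i₂ j h (hj.trans_le (hle i₂))
  · intro a b hab
    by_cases h : a = i ∧ b = lam i - 1
    · simp [setCell, h]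
    · simp only [setCell, h, if_false]
      refine hT.2.2.2 a b ?_
      by_contra hb
      exact absurd ((hlt (a, b)).2 ⟨not_le.1 hb, by simpa using h⟩) (not_lt.2 hab)

theorem IsSYT.setCell_sum (hT : IsSYT (removeCell lam i) T) (hi : 0 < lam i)
    (hcorner : ∀ j, i < j → lam j < lam i) :
    IsSYT lam (setCell T i (lam i - 1) (∑ a, lam a)) := by
  have hlt := lt_removeCell_iff (lam := lam) hi
  have hsum := sum_removeCell hi
  have hne : ∀ a b, ¬ (a = i ∧ b = lam i - 1) →
      setCell T i (lam i - 1) (∑ a, lam a) a b = T a b := by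
    intro a b hab
    simp [setCell, hab]
  have hself : setCell T i (lam i - 1) (∑ a, lam a) i (lam i - 1) = ∑ a, lam a := by
    simp [setCell]
  have hmem : ∀ a b, ¬ (a = i ∧ b = lam i - 1) → b < lam a → b < removeCell lam i a :=
    fun a b h hb => (hlt (a, b)).2 ⟨hb, by simpa using h⟩
  refine ⟨?_, ?_, ?_, ?_⟩
  · have h := (hT.1.congr (f₂ := fun p : Fin m × ℕ =>
        setCell T i (lam i - 1) (∑ a, lam a) p.1 p.2) fun p hp =>
      (hne p.1 p.2 (by simpa [Prod.ext_iff] using ((hlt p).1 hp).2)).symm).insert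
        (a := (i, lam i - 1)) (by simp only [hself, Set.mem_Icc]; omega)
    have hset : insert (∑ a, lam a) (Set.Icc 1 (∑ a, removeCell lam i a)) =
        Set.Icc 1 (∑ a, lam a) := by
      ext k
      simp only [Set.mem_insert_iff, Set.mem_Icc]
      omega
    rw [cells_removeCell hi, Set.insert_sdiff_singleton, Set.insert_eq_of_mem
      (show (i, lam i - 1) ∈ {p : Fin m × ℕ | p.2 < lam p.1} by simpa using hi)] at h
    simpa only [hself, hset] using h
  · intro a j₁ j₂ h h₂
    have h₁ : ¬ (a = i ∧ j₁ = lam i - 1) := by rintro ⟨rfl, rfl⟩; omega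
    rw [hne a j₁ h₁]
    by_cases h₃ : a = i ∧ j₂ = lam i - 1
    · obtain ⟨rfl, rfl⟩ := h₃
      have := hT.le_sum a j₁
      rw [hself]
      omega
    · rw [hne a j₂ h₃]
      exact hT.2.1 a j₁ j₂ h (hmem a j₂ h₃ h₂)
  · intro i₁ i₂ j h hj
    have h₁ : ¬ (i₁ = i ∧ j = lam i - 1) := by
      rintro ⟨rfl, rfl⟩
      have := hcorner i₂ h
      omega
    rw [hne i₁ j h₁]
    by_cases h₃ : i₂ = i ∧ j = lam i - 1
    · obtain ⟨rfl, rfl⟩ := h₃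
      have := hT.le_sum i₁ (lam i₂ - 1)
      rw [hself]
      omega
    · rw [hne i₂ j h₃]
      exact hT.2.2.1 i₁ i₂ j h (hmem i₂ j h₃ hj)
  · intro a b hab
    have h₁ : ¬ (a = i ∧ b = lam i - 1) := by rintro ⟨rfl, rfl⟩; omega
    rw [hne a b h₁]
    refine hT.2.2.2 a b (le_of_not_gt fun h => ?_)
    exact absurd ((hlt (a, b)).1 h).1 (not_lt.2 hab)

/-- Erasing the largest entry identifies the tableaux whose largest entry ends row `i` with the
tableaux of the shape with the corner of row `i` removed. -/
def eraseMaxEquiv (hi : 0 < lam i) (hcorner : ∀ j, i < j → lam j < lam i) :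
    {T // IsSYT lam T ∧ T i (lam i - 1) = ∑ a, lam a} ≃ {T // IsSYT (removeCell lam i) T} where
  toFun T := ⟨setCell T.1 i (lam i - 1) 0, T.2.1.setCell_zero hi T.2.2⟩
  invFun T := ⟨setCell T.1 i (lam i - 1) (∑ a, lam a),
    T.2.setCell_sum hi hcorner, by simp [setCell]⟩
  left_inv := by
    rintro ⟨T, hT, hmax⟩
    ext a b
    by_cases h : a = i ∧ b = lam i - 1
    · simp [setCell, h, hmax]
    · simp [setCell, h]
  right_inv := by
    rintro ⟨T, hT⟩
    ext a b
    by_cases h : a = i ∧ b = lam i - 1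
    · have := hT.2.2.2 i (lam i - 1) removeCell_self.le
      simp [setCell, h, this]
    · simp [setCell, h]

theorem IsSYT.existsUnique_max (hT : IsSYT lam T) (hpos : 0 < ∑ a, lam a) :
    ∃! i, 0 < lam i ∧ T i (lam i - 1) = ∑ a, lam a := by
  obtain ⟨⟨i, j⟩, hij, hmax⟩ := hT.1.surjOn (Set.right_mem_Icc.2 hpos)
  simp only [Set.mem_ofPred_eq] at hij hmax
  have hj : j = lam i - 1 := by
    by_contra hj
    have h1 := hT.2.1 i j (lam i - 1) (by omega) (by omega)
    have h2 := hT.le_sum i (lam i - 1)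
    omega
  subst hj
  refine ⟨i, ⟨by omega, hmax⟩, ?_⟩
  rintro k ⟨hk, hkmax⟩
  exact congrArg Prod.fst (hT.1.injOn
    (show (k, lam k - 1) ∈ {p : Fin m × ℕ | p.2 < lam p.1} by simpa using hk)
    (show (i, lam i - 1) ∈ {p : Fin m × ℕ | p.2 < lam p.1} by simpa using hij)
    (hkmax.trans hmax.symm))

/-- The branching rule for standard Young tableaux. -/
theorem sytCount_eq_sum_removeCell (hlam : ∀ i j : Fin m, i ≤ j → lam j ≤ lam i)
    (hpos : 0 < ∑ a, lam a) :
    sytCount m lam = ∑ i, if 0 < lam i ∧ ∀ j, i < j → lam j < lam i then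
      sytCount m (removeCell lam i) else 0 := by
  have hfib (T : {T // IsSYT lam T}) := T.2.existsUnique_max hpos
  choose g hg huniq using hfib
  rw [sytCount_eq_card, Nat.card_congr (Equiv.sigmaFiberEquiv g).symm, Nat.card_sigma]
  refine Finset.sum_congr rfl fun i _ => ?_
  split_ifs with h
  · rw [sytCount_eq_card, ← Nat.card_congr (eraseMaxEquiv h.1 h.2)]
    refine Nat.card_congr ((Equiv.subtypeEquivRight fun T => ?_).trans
      (Equiv.subtypeSubtypeEquivSubtypeInter (IsSYT lam) fun T => T i (lam i - 1) = ∑ a, lam a))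
    constructor
    · rintro rfl
      exact (hg T).2
    · exact fun hT => (huniq T i ⟨h.1, hT⟩).symm
  · rw [Nat.card_eq_zero]
    left
    constructor
    rintro ⟨T, rfl⟩
    refine h ⟨(hg T).1, fun j hj => lt_of_le_of_ne (hlam _ _ hj.le) fun heq => ?_⟩
    have hpos' := (hg T).1
    have h1 := T.2.2.2.1 (g T) j (lam (g T) - 1) hj (by omega)
    have h2 := T.2.le_sum j (lam (g T) - 1)
    have h3 := (hg T).2
    omega

theorem sytCount_of_sum_eq_zero (h : ∑ a, lam a = 0) : sytCount m lam = 1 := by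
  have h0 : ∀ a, lam a = 0 := by simpa using h
  rw [sytCount_eq_card, Nat.card_eq_one_iff_unique]
  refine ⟨⟨fun T T' => ?_⟩, ⟨⟨fun _ _ => 0, ?_⟩⟩⟩
  · ext a b
    rw [T.2.2.2.2 a b (by simp [h0]), T'.2.2.2.2 a b (by simp [h0])]
  · simp [IsSYT, h0]

end Tableaux

open Matrix in
theorem sum_mul_det_vandermonde_update_add_one {m : ℕ} (y : Fin m → ℤ) :
    ∑ i, y i * (vandermonde (Function.update y i (y i + 1))).det =
      (∑ i, y i + ∑ i : Fin m, ((i : ℕ) : ℤ)) * (vandermonde y).det := by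
  have hdet (v : Fin m → ℤ) := det_eval_matrixOfPolynomials_eq_det_vandermonde v
    (fun i : Fin m => ascPochhammer ℤ i) (fun i => ascPochhammer_natDegree (S := ℤ) i)
    (fun i => monic_ascPochhammer ℤ i)
  have hterm (i : Fin m) (σ : Equiv.Perm (Fin m)) :
      y i * ∏ k : Fin m, (ascPochhammer ℤ k).eval (Function.update y i (y i + 1) (σ k)) =
        (y i + ((σ.symm i : ℕ) : ℤ)) * ∏ k : Fin m, (ascPochhammer ℤ k).eval (y (σ k)) := by
    rw [← Finset.mul_prod_erase _ _ (Finset.mem_univ (σ.symm i)),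
      ← Finset.mul_prod_erase _ (fun k : Fin m => (ascPochhammer ℤ k).eval (y (σ k)))
        (Finset.mem_univ (σ.symm i))]
    have hstep : y i * (ascPochhammer ℤ (σ.symm i)).eval (y i + 1) =
        (y i + ((σ.symm i : ℕ) : ℤ)) * (ascPochhammer ℤ (σ.symm i)).eval (y i) := by
      have h1 := congrArg (Polynomial.eval (y i)) (ascPochhammer_succ_left ℤ (σ.symm i))
      have h2 := ascPochhammer_succ_eval (σ.symm i : ℕ) (y i)
      simp only [Polynomial.eval_mul, Polynomial.eval_X, Polynomial.eval_comp,
        Polynomial.eval_add, Polynomial.eval_one] at h1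
      rw [← h1, h2, mul_comm]
    have hrest : ∏ k ∈ Finset.univ.erase (σ.symm i),
          (ascPochhammer ℤ k).eval (Function.update y i (y i + 1) (σ k)) =
        ∏ k ∈ Finset.univ.erase (σ.symm i), (ascPochhammer ℤ k).eval (y (σ k)) := by
      refine Finset.prod_congr rfl fun k hk => ?_
      have : σ k ≠ i := fun h => (Finset.mem_erase.1 hk).1 (by simp [← h])
      rw [Function.update_of_ne this]
    rw [hrest, Equiv.apply_symm_apply, Function.update_self, ← mul_assoc, hstep, mul_assoc]
  simp only [hdet, det_apply', of_apply, Finset.mul_sum]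
  rw [Finset.sum_comm]
  refine Finset.sum_congr rfl fun σ _ => ?_
  rw [← Equiv.sum_comp σ.symm fun i : Fin m => ((i : ℕ) : ℤ), ← Finset.sum_add_distrib,
    Finset.sum_mul]
  refine Finset.sum_congr rfl fun i _ => ?_
  rw [mul_left_comm, hterm i σ, mul_left_comm]

theorem prod_factorial_eq_det_vandermonde (m : ℕ) :
    ∏ i : Fin m, ((m - 1 - (i : ℕ)).factorial : ℤ) =
      (Matrix.vandermonde fun i : Fin m => ((i : ℕ) : ℤ)).det := by
  cases m with
  | zero => simp
  | succ m =>
    rw [Matrix.det_vandermonde_id_eq_superFactorial,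
      Fin.prod_univ_eq_prod_range (fun i => ((m + 1 - 1 - i).factorial : ℤ)) (m + 1),
      Finset.prod_range_reflect (fun i => (i.factorial : ℤ)) (m + 1), ← Nat.cast_prod,
      Nat.prod_range_succ_factorial]

/-- The negated shifted parts `i - lam i - (m - 1)` of `lam`. -/
def negShift {m : ℕ} (lam : Fin m → ℕ) (i : Fin m) : ℤ :=
  (i : ℕ) - (lam i : ℤ) - ((m : ℤ) - 1)

section MacMahon

variable {m : ℕ} {lam : Fin m → ℕ} {i : Fin m}

theorem negShift_eq : negShift lam i = -((lam i + (m - 1 - (i : ℕ)) : ℕ) : ℤ) := by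
  have := i.2
  unfold negShift
  omega

theorem negShift_removeCell (hi : 0 < lam i) :
    negShift (removeCell lam i) = Function.update (negShift lam) i (negShift lam i + 1) := by
  ext a
  by_cases h : a = i
  · subst h
    simp only [negShift, removeCell_self, Function.update_self]
    omega
  · simp [negShift, removeCell_of_ne h, h]

theorem sum_negShift :
    ∑ i, negShift lam i + ∑ i : Fin m, ((i : ℕ) : ℤ) = -((∑ i, lam i : ℕ) : ℤ) := by
  have hrev : ∑ i : Fin m, ((m : ℤ) - 1 - (i : ℕ)) = ∑ i : Fin m, ((i : ℕ) : ℤ) := by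
    rw [← Equiv.sum_comp Fin.revPerm fun i : Fin m => ((i : ℕ) : ℤ)]
    refine Finset.sum_congr rfl fun i _ => ?_
    have := i.2
    simp only [Fin.revPerm_apply, Fin.val_rev]
    omega
  rw [← hrev, ← Finset.sum_add_distrib, Nat.cast_sum, ← Finset.sum_neg_distrib]
  refine Finset.sum_congr rfl fun i _ => ?_
  unfold negShift
  ring

theorem det_vandermonde_negShift :
    (Matrix.vandermonde (negShift lam)).det =
      ∏ p ∈ Finset.univ.filter (fun p : Fin m × Fin m => p.1 < p.2),
        ((lam p.1 : ℤ) - (lam p.2 : ℤ) - ((p.1 : ℕ) : ℤ) + ((p.2 : ℕ) : ℤ)) := by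
  rw [Matrix.det_vandermonde, Finset.prod_filter, ← Finset.univ_product_univ,
    Finset.prod_product]
  refine Finset.prod_congr rfl fun i _ => ?_
  rw [← Finset.prod_filter, Finset.filter_lt_eq_Ioi]
  refine Finset.prod_congr rfl fun j _ => ?_
  unfold negShift
  ring

theorem mul_prod_factorial_removeCell (hi : 0 < lam i) :
    -negShift lam i * ∏ a : Fin m, ((removeCell lam i a + (m - 1 - (a : ℕ))).factorial : ℤ) =
      ∏ a : Fin m, ((lam a + (m - 1 - (a : ℕ))).factorial : ℤ) := by
  rw [← Finset.mul_prod_erase _ _ (Finset.mem_univ i),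
    ← Finset.mul_prod_erase _ (fun a : Fin m => ((lam a + (m - 1 - (a : ℕ))).factorial : ℤ))
      (Finset.mem_univ i), ← mul_assoc]
  congr 1
  · obtain ⟨k, hk⟩ : ∃ k, lam i = k + 1 := ⟨lam i - 1, by omega⟩
    rw [negShift_eq, neg_neg, removeCell_self, hk, Nat.add_sub_cancel, Nat.add_right_comm,
      Nat.factorial_succ]
    push_cast
    ring
  · refine Finset.prod_congr rfl fun a ha => ?_
    rw [removeCell_of_ne (Finset.ne_of_mem_erase ha)]

theorem removeCell_antitone (hlam : ∀ i j : Fin m, i ≤ j → lam j ≤ lam i)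
    (hcorner : ∀ j, i < j → lam j < lam i) (a b : Fin m) (hab : a ≤ b) :
    removeCell lam i b ≤ removeCell lam i a := by
  have h1 := hlam a b hab
  rcases eq_or_ne a i with rfl | ha
  · rcases eq_or_ne b a with rfl | hb
    · exact le_rfl
    · have := hcorner b (lt_of_le_of_ne hab hb.symm)
      rw [removeCell_self, removeCell_of_ne hb]
      omega
  · rw [removeCell_of_ne ha]
    rcases eq_or_ne b i with rfl | hb
    · rw [removeCell_self]
      omega
    · rwa [removeCell_of_ne hb]

/-- The terms of the recursion for the Vandermonde determinant vanish away from the corners. -/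
theorem negShift_mul_det_eq_zero (hlam : ∀ i j : Fin m, i ≤ j → lam j ≤ lam i)
    (h : ¬ (0 < lam i ∧ ∀ j, i < j → lam j < lam i)) :
    negShift lam i *
      (Matrix.vandermonde (Function.update (negShift lam) i (negShift lam i + 1))).det = 0 := by
  rw [mul_eq_zero]
  have hi := i.2
  by_cases hlast : (i : ℕ) + 1 < m
  · right
    let j : Fin m := ⟨i + 1, hlast⟩
    have hij : i < j := Nat.lt_succ_self i
    have heq : lam j = lam i := by
      refine le_antisymm (hlam i j hij.le) (le_of_not_gt fun hlt => h ⟨by omega, fun k hk => ?_⟩)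
      exact (hlam j k (Nat.succ_le_of_lt hk)).trans_lt hlt
    rw [Matrix.det_vandermonde_eq_zero_iff]
    refine ⟨i, j, ?_, hij.ne⟩
    rw [Function.update_self, Function.update_of_ne hij.ne']
    simp only [negShift, heq, j]
    push_cast
    ring
  · left
    have : lam i = 0 := by
      by_contra hne
      refine h ⟨by omega, fun k hk => ?_⟩
      have := k.2
      have : (i : ℕ) < k := hk
      omega
    rw [negShift_eq, this]
    omega

theorem sytCount_mul_prod_factorial (n : ℕ) (lam : Fin m → ℕ) (hn : ∑ i, lam i = n)
    (hlam : ∀ i j : Fin m, i ≤ j → lam j ≤ lam i) :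
    (sytCount m lam : ℤ) * ∏ i : Fin m, ((lam i + (m - 1 - (i : ℕ))).factorial : ℤ) =
      (n.factorial : ℤ) * (Matrix.vandermonde (negShift lam)).det := by
  induction n generalizing lam with
  | zero =>
    have h0 : ∀ a, lam a = 0 := by simpa using hn
    have hdet := Matrix.det_vandermonde_sub (fun i : Fin m => ((i : ℕ) : ℤ)) ((m : ℤ) - 1)
    have hshift : negShift lam = fun i : Fin m => ((i : ℕ) : ℤ) - ((m : ℤ) - 1) := by
      ext i
      simp [negShift, h0]
    rw [sytCount_of_sum_eq_zero hn, hshift, hdet, ← prod_factorial_eq_det_vandermonde]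
    simp [h0]
  | succ n ih =>
    have hrec := sum_mul_det_vandermonde_update_add_one (negShift lam)
    rw [sum_negShift, hn] at hrec
    have hsum : (∑ i, -(negShift lam i *
        (Matrix.vandermonde (Function.update (negShift lam) i (negShift lam i + 1))).det)) =
        ((n + 1 : ℕ) : ℤ) * (Matrix.vandermonde (negShift lam)).det := by
      rw [Finset.sum_neg_distrib, hrec]
      ring
    rw [Nat.factorial_succ, mul_comm (n + 1), Nat.cast_mul, mul_assoc, ← hsum,
      sytCount_eq_sum_removeCell hlam (by omega), Nat.cast_sum, Finset.sum_mul, Finset.mul_sum]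
    refine Finset.sum_congr rfl fun i _ => ?_
    split_ifs with h
    · have hrem := ih (removeCell lam i) (by have := sum_removeCell h.1; omega)
        (removeCell_antitone hlam h.2)
      rw [negShift_removeCell h.1] at hrem
      rw [← mul_prod_factorial_removeCell h.1]
      linear_combination (-negShift lam i) * hrem
    · rw [negShift_mul_det_eq_zero hlam h]
      simp

end MacMahon

/-- MacMahon's formula: `f^λ · ∏_i (λ_i−i+m)! = n! · ∏_{i<j} (λ_i−λ_j−i+j)`.
With 0-based indices `i`, `(λ_i−i+m)!` becomes `(λ_i+(m−1−i))!` and the factor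
`λ_i−λ_j−i+j` becomes `λ_i−λ_j−i+j` with `i,j` 0-based (the same integer). -/
theorem macmahon (m : ℕ) (hm : 1 ≤ m) (lam : Fin m → ℕ)
    (hlam : ∀ i j : Fin m, i ≤ j → lam j ≤ lam i) :
    (sytCount m lam : ℤ) *
        ∏ i : Fin m, (Nat.factorial (lam i + (m - 1 - (i : ℕ))) : ℤ)
      = (Nat.factorial (∑ i, lam i) : ℤ) *
        ∏ p ∈ Finset.univ.filter (fun p : Fin m × Fin m => p.1 < p.2),
          ((lam p.1 : ℤ) - (lam p.2 : ℤ) - ((p.1 : ℕ) : ℤ) + ((p.2 : ℕ) : ℤ)) := by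
  rw [sytCount_mul_prod_factorial _ lam rfl hlam, det_vandermonde_negShift]
end
end
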